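/- Every polynomial f ∈ ℝ[x,y] of total degree 3 satisfies f ≈ g for some polynomial g in the Table (automorphic classification of cubic curves); moreover, the polynomials listed in the Table are pairwise inequivalent with respect to ≈, i.e., if g₁ and g₂ are distinct polynomials from the Table then g₁ ≈ g₂ fails. -/

import Mathlib

open MvPolynomial

/-- The polynomial ring `ℝ[x,y]`, realized as `MvPolynomial (Fin 2) ℝ`
with `X 0 = x` and `X 1 = y`. -/
abbrev P2 : Type := MvPolynomial (Fin 2) ℝ

/-- `f ∼ g` : there are an affine automorphism `θ ∈ Γ₂(ℝ)` (a ring automorphism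
of `ℝ[x,y]` sending `x` and `y` to polynomials of total degree at most 1)
and a nonzero `c ∈ ℝ` with `θ f = c • g`. -/
def AffEquiv (f g : P2) : Prop :=
  ∃ θ : P2 ≃+* P2, (θ (X 0)).totalDegree ≤ 1 ∧ (θ (X 1)).totalDegree ≤ 1 ∧
    ∃ c : ℝ, c ≠ 0 ∧ θ f = C c * g

/-- `f ≈ g` : there are a ring automorphism `φ` of `ℝ[x,y]` and a nonzero
`c ∈ ℝ` with `φ f = c • g`. -/
def AutEquiv (f g : P2) : Prop :=
  ∃ φ : P2 ≃+* P2, ∃ c : ℝ, c ≠ 0 ∧ φ f = C c * g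

/-- The table entries with canonical form `x³ + x·y²`. -/
def FamA (p : P2) : Prop :=
  (∃ H I J : ℝ, 0 ≤ I ∧
    p = X 0 ^ 3 + X 0 * X 1 ^ 2 + X 0 ^ 2 + C H * X 0 + C I * X 1 + C J) ∨
  (∃ H J : ℝ, 0 ≤ J ∧
    p = X 0 ^ 3 + X 0 * X 1 ^ 2 + X 1 + C H * X 0 + C J) ∨
  (∃ e J : ℝ, (e = 1 ∨ e = -1) ∧ 0 ≤ J ∧
    p = X 0 ^ 3 + X 0 * X 1 ^ 2 + C e * X 0 + C J) ∨
  p = X 0 ^ 3 + X 0 * X 1 ^ 2 + 1 ∨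
  p = X 0 ^ 3 + X 0 * X 1 ^ 2

/-- The table entries with canonical form `x³ - x·y²`. -/
def FamB (p : P2) : Prop :=
  (∃ H I J : ℝ, 0 ≤ I ∧ H + I ≤ -(3/4 : ℝ) ∧
    p = X 0 ^ 3 - X 0 * X 1 ^ 2 - X 1 ^ 2 + C H * X 0 + C I * X 1 + C J) ∨
  (∃ H J : ℝ, 0 ≤ J ∧ -1 ≤ H ∧ H ≤ 1 ∧
    p = X 0 ^ 3 - X 0 * X 1 ^ 2 - X 1 + C H * X 0 + C J) ∨
  p = X 0 ^ 3 - X 0 * X 1 ^ 2 + 1 ∨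
  p = X 0 ^ 3 - X 0 * X 1 ^ 2

/-- The table entries with canonical form `x²·y`. -/
def FamC (p : P2) : Prop :=
  (∃ I J : ℝ, p = X 0 ^ 2 * X 1 + X 1 ^ 2 - X 0 + C I * X 1 + C J) ∨
  (∃ e J : ℝ, (e = 1 ∨ e = -1) ∧
    p = X 0 ^ 2 * X 1 + X 1 ^ 2 + C e * X 1 + C J) ∨
  (∃ e : ℝ, (e = 1 ∨ e = -1) ∧ p = X 0 ^ 2 * X 1 + X 1 ^ 2 + C e) ∨
  p = X 0 ^ 2 * X 1 + X 1 ^ 2 ∨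
  (∃ e J : ℝ, (e = 1 ∨ e = -1) ∧ 0 ≤ J ∧
    p = X 0 ^ 2 * X 1 - X 0 + C e * X 1 + C J) ∨
  (∃ e : ℝ, (e = 1 ∨ e = -1) ∧ p = X 0 ^ 2 * X 1 + C e * X 1 + 1) ∨
  (∃ e : ℝ, (e = 1 ∨ e = -1) ∧ p = X 0 ^ 2 * X 1 + C e * X 1) ∨
  p = X 0 ^ 2 * X 1 - X 0 + 1 ∨
  p = X 0 ^ 2 * X 1 - X 0 ∨
  p = X 0 ^ 2 * X 1 - 1 ∨
  p = X 0 ^ 2 * X 1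

/-- The table entries with canonical form `x³`. -/
def FamD (p : P2) : Prop :=
  (∃ e J : ℝ, (e = 1 ∨ e = -1) ∧
    p = X 0 ^ 3 - X 1 ^ 2 + C e * X 0 + C J) ∨
  (∃ e : ℝ, (e = 1 ∨ e = -1) ∧ p = X 0 ^ 3 - X 1 ^ 2 + C e) ∨
  p = X 0 ^ 3 - X 1 ^ 2 ∨
  p = X 0 ^ 3 - X 1 ∨
  p = X 0 ^ 3 - X 0 * X 1 + 1 ∨
  p = X 0 ^ 3 - X 0 * X 1 ∨
  (∃ e J : ℝ, (e = 1 ∨ e = -1) ∧ 0 ≤ J ∧ p = X 0 ^ 3 + C e * X 0 + C J) ∨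
  p = X 0 ^ 3 + 1 ∨
  p = X 0 ^ 3

/-- The full table: the affine/automorphic classification of cubic curves. -/
def InTable (p : P2) : Prop := FamA p ∨ FamB p ∨ FamC p ∨ FamD p


/-- The value of a bivariate real polynomial at a point. -/
noncomputable def ev (f : P2) (x y : ℝ) : ℝ := eval ![x, y] f

lemma ev_ext {f g : P2} (h : ∀ x y, ev f x y = ev g x y) : f = g := by
  refine MvPolynomial.funext fun v => ?_
  have hv : v = ![v 0, v 1] := by
    ext i; fin_cases i <;> rfl
  rw [hv]
  exact h _ _

lemma ev_aeval (f F G : P2) (x y : ℝ) : ev (aeval ![F, G] f) x y = ev f (ev F x y) (ev G x y) := by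
  induction f using MvPolynomial.induction_on with
  | C r => simp [ev]
  | add p q hp hq => simp_all [ev]
  | mul_X p i hp => fin_cases i <;> simp_all [ev]

/-- `f` becomes a nonzero multiple of `g` after an invertible affine substitution. -/
def AffRel (f g : P2) : Prop :=
  ∃ a b p c d q k : ℝ, a * d - b * c ≠ 0 ∧ k ≠ 0 ∧
    ∀ x y, ev f (a * x + b * y + p) (c * x + d * y + q) = k * ev g x y

/-- The affine substitution `x ↦ ax + by + p`, `y ↦ cx + dy + q`. -/
noncomputable def affHom (a b p c d q : ℝ) : P2 →ₐ[ℝ] P2 :=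
  aeval ![C a * X 0 + C b * X 1 + C p, C c * X 0 + C d * X 1 + C q]

lemma ev_affHom (a b p c d q : ℝ) (f : P2) (x y : ℝ) :
    ev (affHom a b p c d q f) x y = ev f (a * x + b * y + p) (c * x + d * y + q) := by
  rw [affHom, ev_aeval]
  simp [ev]

lemma affHom_comp_inv {a b c d : ℝ} (p q : ℝ) (h : a * d - b * c ≠ 0) (f : P2) :
    affHom (d / (a * d - b * c)) (-b / (a * d - b * c)) ((b * q - d * p) / (a * d - b * c))
      (-c / (a * d - b * c)) (a / (a * d - b * c)) ((c * p - a * q) / (a * d - b * c))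
      (affHom a b p c d q f) = f := by
  refine ev_ext fun x y => ?_
  rw [ev_affHom, ev_affHom]
  generalize hD : a * d - b * c = D at *
  congr 1 <;> field_simp <;> rw [← hD] <;> ring

lemma affHom_inv_comp {a b c d : ℝ} (p q : ℝ) (h : a * d - b * c ≠ 0) (f : P2) :
    affHom a b p c d q
      (affHom (d / (a * d - b * c)) (-b / (a * d - b * c)) ((b * q - d * p) / (a * d - b * c))
      (-c / (a * d - b * c)) (a / (a * d - b * c)) ((c * p - a * q) / (a * d - b * c)) f) = f := by
  refine ev_ext fun x y => ?_
  rw [ev_affHom, ev_affHom]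
  generalize hD : a * d - b * c = D at *
  congr 1 <;> field_simp <;> rw [← hD] <;> ring

/-- An invertible affine substitution as an automorphism. -/
noncomputable def affEquiv {a b c d : ℝ} (p q : ℝ) (h : a * d - b * c ≠ 0) : P2 ≃+* P2 :=
  { (affHom a b p c d q : P2 →+* P2) with
    invFun := affHom (d / (a * d - b * c)) (-b / (a * d - b * c)) ((b * q - d * p) / (a * d - b * c))
      (-c / (a * d - b * c)) (a / (a * d - b * c)) ((c * p - a * q) / (a * d - b * c))
    left_inv := affHom_comp_inv p q h
    right_inv := affHom_inv_comp p q h }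

lemma ev_affEquiv {a b c d : ℝ} (p q : ℝ) (h : a * d - b * c ≠ 0) (f : P2) (x y : ℝ) :
    ev (affEquiv p q h f) x y = ev f (a * x + b * y + p) (c * x + d * y + q) :=
  ev_affHom a b p c d q f x y

lemma AffRel.autEquiv {f g : P2} (h : AffRel f g) : AutEquiv f g := by
  obtain ⟨a, b, p, c, d, q, k, hdet, hk, h⟩ := h
  refine ⟨affEquiv p q hdet, k, hk, ev_ext fun x y => ?_⟩
  rw [ev_affEquiv, h]
  simp [ev]

lemma ringEquiv_C (φ : P2 ≃+* P2) (r : ℝ) : φ (C r) = C r := by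
  have key : ∀ r : ℝ, φ (C r) = C (ev (φ (C r)) 0 0) := by
    intro r
    by_cases hr : r = 0
    · simp [hr, ev]
    have hu : IsUnit (φ (C r)) := ((isUnit_iff_ne_zero.mpr hr).map (C : ℝ →+* P2)).map φ
    obtain ⟨s, -, hs⟩ := MvPolynomial.isUnit_iff_eq_C_of_isReduced.mp hu
    rw [hs]; simp [ev]
  have : ((eval ![0, 0]).comp ((φ : P2 →+* P2).comp C) : ℝ →+* ℝ) = RingHom.id ℝ :=
    Subsingleton.elim _ _
  rw [key r]
  exact congrArg C (congrArg (fun t : ℝ →+* ℝ => t r) this)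

lemma ringEquiv_apply (φ : P2 ≃+* P2) (f : P2) : φ f = aeval ![φ (X 0), φ (X 1)] f := by
  induction f using MvPolynomial.induction_on with
  | C r => simp [ringEquiv_C]
  | add p q hp hq => simp [hp, hq]
  | mul_X p i hp => fin_cases i <;> simp [hp]

lemma AutEquiv.symm {f g : P2} (h : AutEquiv f g) : AutEquiv g f := by
  obtain ⟨φ, c, hc, h⟩ := h
  refine ⟨φ.symm, c⁻¹, inv_ne_zero hc, ?_⟩
  have h2 : f = C c * φ.symm g := by
    rw [← φ.symm_apply_apply f, h, map_mul, ringEquiv_C]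
  rw [h2, ← mul_assoc, ← C_mul, inv_mul_cancel₀ hc, C_1, one_mul]

lemma AutEquiv.trans {f g h : P2} (h₁ : AutEquiv f g) (h₂ : AutEquiv g h) : AutEquiv f h := by
  obtain ⟨φ, c, hc, h₁⟩ := h₁
  obtain ⟨ψ, d, hd, h₂⟩ := h₂
  refine ⟨φ.trans ψ, c * d, mul_ne_zero hc hd, ?_⟩
  rw [RingEquiv.trans_apply, h₁, map_mul, ringEquiv_C, h₂, C_mul, mul_assoc]

/-- The exponent vector of `x ^ i * y ^ j`. -/
noncomputable def expo (i j : ℕ) : Fin 2 →₀ ℕ := Finsupp.single 0 i + Finsupp.single 1 j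

lemma eq_expo (m : Fin 2 →₀ ℕ) : m = expo (m 0) (m 1) := by
  ext i; fin_cases i <;> simp [expo]

lemma degree_eq (m : Fin 2 →₀ ℕ) : (m.sum fun _ e => e) = m 0 + m 1 := by
  rw [Finsupp.sum_fintype _ _ (fun _ => rfl), Fin.sum_univ_two]

lemma ev_monomial (i j : ℕ) (r x y : ℝ) : ev (monomial (expo i j) r) x y = r * (x ^ i * y ^ j) := by
  rw [ev, eval_monomial, Finsupp.prod_fintype _ _ (by simp), Fin.prod_univ_two]
  simp [expo]

lemma coeff_expo_eq_zero {f : P2} {i j : ℕ} (h : f.totalDegree < i + j) :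
    coeff (expo i j) f = 0 := by
  apply coeff_eq_zero_of_totalDegree_lt
  change _ < (expo i j).sum fun _ e => e
  rw [degree_eq]
  simpa [expo] using h

lemma ev_eq_sum {f : P2} {n : ℕ} (h : f.totalDegree ≤ n) (x y : ℝ) :
    ev f x y = ∑ i ∈ Finset.range (n + 1), ∑ j ∈ Finset.range (n + 1),
      coeff (expo i j) f * (x ^ i * y ^ j) := by
  have hf : f = ∑ i ∈ Finset.range (n + 1), ∑ j ∈ Finset.range (n + 1),
      monomial (expo i j) (coeff (expo i j) f) := by
    ext m
    simp only [coeff_sum, coeff_monomial]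
    by_cases hm : m 0 < n + 1 ∧ m 1 < n + 1
    · rw [Finset.sum_eq_single (m 0), Finset.sum_eq_single (m 1)]
      · rw [← eq_expo m]; simp
      · intro j _ hj
        rw [if_neg]
        intro h'
        exact hj (by rw [← h']; simp [expo])
      · intro hj
        exact absurd (Finset.mem_range.mpr hm.2) hj
      · intro i _ hi
        refine Finset.sum_eq_zero fun j _ => ?_
        rw [if_neg]
        rintro rfl
        simp [expo] at hi
      · intro hj
        exact absurd (Finset.mem_range.mpr hm.1) hj
    · rw [Finset.sum_eq_zero]
      · rw [eq_expo m]
        exact coeff_expo_eq_zero (by omega)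
      · intro i hi
        refine Finset.sum_eq_zero fun j hj => ?_
        rw [if_neg]
        rintro rfl
        simp [expo] at hm hi hj
        omega
  conv_lhs => rw [hf]
  simp only [ev, map_sum]
  exact Finset.sum_congr rfl fun i _ => Finset.sum_congr rfl fun j _ => ev_monomial i j _ x y

lemma ev_linear {f : P2} (h : f.totalDegree ≤ 1) :
    ∃ a b p : ℝ, ∀ x y, ev f x y = a * x + b * y + p := by
  refine ⟨coeff (expo 1 0) f, coeff (expo 0 1) f, coeff (expo 0 0) f, fun x y => ?_⟩
  rw [ev_eq_sum h]
  have h11 : coeff (expo 1 1) f = 0 := coeff_expo_eq_zero (by omega)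
  simp [Finset.sum_range_succ, h11]
  ring

lemma ev_quadratic {f : P2} (h : f.totalDegree ≤ 2) :
    ∃ a b c d e k : ℝ, ∀ x y, ev f x y =
      a * x ^ 2 + b * (x * y) + c * y ^ 2 + d * x + e * y + k := by
  refine ⟨coeff (expo 2 0) f, coeff (expo 1 1) f, coeff (expo 0 2) f, coeff (expo 1 0) f,
    coeff (expo 0 1) f, coeff (expo 0 0) f, fun x y => ?_⟩
  rw [ev_eq_sum h]
  have h1 : coeff (expo 1 2) f = 0 := coeff_expo_eq_zero (by omega)
  have h2 : coeff (expo 2 1) f = 0 := coeff_expo_eq_zero (by omega)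
  have h3 : coeff (expo 2 2) f = 0 := coeff_expo_eq_zero (by omega)
  simp [Finset.sum_range_succ, h1, h2, h3]
  ring

lemma ev_cubic {f : P2} (h : f.totalDegree ≤ 3) :
    ∃ c₁ c₂ c₃ c₄ a b c d e k : ℝ, ∀ x y, ev f x y =
      c₁ * x ^ 3 + c₂ * (x ^ 2 * y) + c₃ * (x * y ^ 2) + c₄ * y ^ 3 +
        (a * x ^ 2 + b * (x * y) + c * y ^ 2 + d * x + e * y + k) := by
  refine ⟨coeff (expo 3 0) f, coeff (expo 2 1) f, coeff (expo 1 2) f, coeff (expo 0 3) f,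
    coeff (expo 2 0) f, coeff (expo 1 1) f, coeff (expo 0 2) f, coeff (expo 1 0) f,
    coeff (expo 0 1) f, coeff (expo 0 0) f, fun x y => ?_⟩
  rw [ev_eq_sum h]
  have h1 : coeff (expo 1 3) f = 0 := coeff_expo_eq_zero (by omega)
  have h2 : coeff (expo 2 2) f = 0 := coeff_expo_eq_zero (by omega)
  have h3 : coeff (expo 2 3) f = 0 := coeff_expo_eq_zero (by omega)
  have h4 : coeff (expo 3 1) f = 0 := coeff_expo_eq_zero (by omega)
  have h5 : coeff (expo 3 2) f = 0 := coeff_expo_eq_zero (by omega)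
  have h6 : coeff (expo 3 3) f = 0 := coeff_expo_eq_zero (by omega)
  simp [Finset.sum_range_succ, h1, h2, h3, h4, h5, h6]
  ring

lemma ev_ringEquiv (φ : P2 ≃+* P2) (f : P2) (x y : ℝ) :
    ev (φ f) x y = ev f (ev (φ (X 0)) x y) (ev (φ (X 1)) x y) := by
  rw [ringEquiv_apply, ev_aeval]

lemma AffEquiv.affRel {f g : P2} (h : AffEquiv f g) : AffRel f g := by
  obtain ⟨φ, h0, h1, k, hk, h⟩ := h
  obtain ⟨a, b, p, hF⟩ := ev_linear h0
  obtain ⟨c, d, q, hG⟩ := ev_linear h1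
  refine ⟨a, b, p, c, d, q, k, fun hdet => ?_, hk, fun x y => ?_⟩
  · have key : ∀ s t : ℝ, s * a + t * c = 0 → s * b + t * d = 0 → s = 0 ∧ t = 0 := by
      intro s t hx hy
      have : φ (C s * X 0 + C t * X 1) = φ (C (s * p + t * q)) := by
        refine ev_ext fun x y => ?_
        rw [ev_ringEquiv, ringEquiv_C]
        simp only [hF, hG]
        simp only [ev, map_add, map_mul, eval_C, eval_X, Matrix.cons_val_zero, Matrix.cons_val_one]
        linear_combination x * hx + y * hy
      have h2 := φ.injective this
      have e00 := congrArg (fun r => ev r 0 0) h2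
      have e10 := congrArg (fun r => ev r 1 0) h2
      have e01 := congrArg (fun r => ev r 0 1) h2
      simp [ev] at e00 e10 e01
      constructor <;> linarith
    have k1 := key d (-b) (by linarith) (by ring)
    have k2 := key (-c) a (by ring) (by linarith)
    have := key 1 0 (by simp [k2.2]) (by linarith [k1.2])
    simp at this
  · have := congrArg (fun r => ev r x y) h
    simp only [ev_ringEquiv, hF, hG] at this
    rw [this]; simp [ev]

/-- Coefficient comparison for real bivariate cubics. -/
lemma cubic_coeff_eq_zero {c₁ c₂ c₃ c₄ a b c d e k : ℝ}
    (h : ∀ x y : ℝ, c₁ * x ^ 3 + c₂ * (x ^ 2 * y) + c₃ * (x * y ^ 2) + c₄ * y ^ 3 +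
        (a * x ^ 2 + b * (x * y) + c * y ^ 2 + d * x + e * y + k) = 0) :
    (c₁ = 0 ∧ c₂ = 0 ∧ c₃ = 0 ∧ c₄ = 0) ∧ a = 0 ∧ b = 0 ∧ c = 0 ∧ d = 0 ∧ e = 0 ∧ k = 0 := by
  have h1 := h 0 0
  have h2 := h 1 0
  have h3 := h (-1) 0
  have h4 := h 2 0
  have h5 := h 0 1
  have h6 := h 0 (-1)
  have h7 := h 0 2
  have h8 := h 1 1
  have h9 := h 1 (-1)
  have h10 := h (-1) 1
  norm_num at h1 h2 h3 h4 h5 h6 h7 h8 h9 h10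
  refine ⟨⟨?_, ?_, ?_, ?_⟩, ?_, ?_, ?_, ?_, ?_, ?_⟩ <;> linarith

lemma C_two : (C 2 : P2) = 2 := map_ofNat C 2

lemma totalDegree_C_mul_of_ne_zero {c : ℝ} (hc : c ≠ 0) (g : P2) :
    (C c * g).totalDegree = g.totalDegree := by
  by_cases hg : g = 0
  · simp [hg]
  · rw [totalDegree_mul_of_isDomain (by simpa using hc) hg, totalDegree_C, zero_add]

lemma totalDegree_C_mul_le (c : ℝ) (g : P2) : (C c * g).totalDegree ≤ g.totalDegree := by
  simpa using totalDegree_mul (C c) g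

lemma ne_zero_of_totalDegree_pos {f : P2} (h : 1 ≤ f.totalDegree) : f ≠ 0 := by
  rintro rfl; simp at h

lemma totalDegree_mul_of_pos {f g : P2} (hf : 1 ≤ f.totalDegree) (hg : 1 ≤ g.totalDegree) :
    (f * g).totalDegree = f.totalDegree + g.totalDegree :=
  totalDegree_mul_of_isDomain (ne_zero_of_totalDegree_pos hf) (ne_zero_of_totalDegree_pos hg)

lemma totalDegree_add_of_lt {f g : P2} (h : g.totalDegree < f.totalDegree) :
    (f + g).totalDegree = f.totalDegree :=
  totalDegree_add_eq_left_of_totalDegree_lt h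

lemma totalDegree_linear_le {F G : P2} {M : ℕ} (hF : F.totalDegree ≤ M) (hG : G.totalDegree ≤ M)
    (d e k : ℝ) : (C d * F + C e * G + C k).totalDegree ≤ M := by
  refine (totalDegree_add _ _).trans (max_le ((totalDegree_add _ _).trans (max_le ?_ ?_)) (by simp))
  · exact (totalDegree_C_mul_le _ _).trans hF
  · exact (totalDegree_C_mul_le _ _).trans hG

lemma totalDegree_quadratic_le {F G : P2} {M : ℕ} (hF : F.totalDegree ≤ M) (hG : G.totalDegree ≤ M)
    (a b d e k : ℝ) :
    (C a * F ^ 2 + C b * G ^ 2 + (C d * F + C e * G + C k)).totalDegree ≤ 2 * M := by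
  refine (totalDegree_add _ _).trans (max_le ((totalDegree_add _ _).trans (max_le ?_ ?_)) ?_)
  · refine (totalDegree_C_mul_le _ _).trans ((totalDegree_pow _ _).trans ?_); omega
  · refine (totalDegree_C_mul_le _ _).trans ((totalDegree_pow _ _).trans ?_); omega
  · exact (totalDegree_linear_le hF hG d e k).trans (by omega)

lemma one_le_totalDegree_ringEquiv (φ : P2 ≃+* P2) {f : P2} (hf : ∀ r, f ≠ C r) :
    1 ≤ (φ f).totalDegree := by
  by_contra h
  have h0 : (φ f).totalDegree = 0 := by omega
  rw [totalDegree_eq_zero_iff_eq_C, ← ringEquiv_C φ] at h0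
  exact hf _ (φ.injective h0)

lemma ne_C_of_ev_ne {f : P2} {x y u v : ℝ} (h : ev f x y ≠ ev f u v) (r : ℝ) : f ≠ C r := by
  rintro rfl
  exact h (by simp [ev])

/-- The part of `f` of degree `n`, with a remainder of lower degree. -/
lemma exists_leading_form {f : P2} {n : ℕ} (hn : 1 ≤ n) (hf : f.totalDegree ≤ n) :
    ∃ h r : P2, f = h + r ∧ h.IsHomogeneous n ∧ r.totalDegree < n := by
  refine ⟨homogeneousComponent n f, f - homogeneousComponent n f, by ring,
    homogeneousComponent_isHomogeneous n f, ?_⟩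
  rw [totalDegree, Finset.sup_lt_iff (by exact hn)]
  intro m hm
  rw [mem_support_iff, coeff_sub, coeff_homogeneousComponent] at hm
  by_contra hlt
  split_ifs at hm with h
  · simp at hm
  · rw [sub_zero] at hm
    apply hm
    apply coeff_eq_zero_of_totalDegree_lt
    have h1 : m.degree = m.sum fun _ e => e := rfl
    have h2 : (∑ i ∈ m.support, m i) = m.sum fun _ e => e := rfl
    omega

lemma eq_zero_of_sq_add_sq_eq_zero {f g : P2} (h : f ^ 2 + g ^ 2 = 0) : f = 0 := by
  refine ev_ext fun x y => ?_
  have := congrArg (fun r => ev r x y) h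
  simp only [ev, map_add, map_pow, map_zero] at this ⊢
  nlinarith [sq_nonneg (eval ![x, y] f), sq_nonneg (eval ![x, y] g)]

lemma totalDegree_sq_add_sq {f g : P2} (hf : 1 ≤ f.totalDegree) :
    (f ^ 2 + g ^ 2).totalDegree = 2 * max f.totalDegree g.totalDegree := by
  set M := max f.totalDegree g.totalDegree with hM
  have hM1 : 1 ≤ M := hf.trans (le_max_left _ _)
  refine le_antisymm ?_ ?_
  · refine (totalDegree_add _ _).trans (max_le ((totalDegree_pow _ _).trans ?_)
      ((totalDegree_pow _ _).trans ?_)) <;> omega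
  by_contra hlt
  obtain ⟨p, r, hp, hph, hr⟩ := exists_leading_form (n := M) (by omega) (le_max_left _ _)
  obtain ⟨q, s, hq, hqh, hs⟩ := exists_leading_form (n := M) (by omega) (le_max_right _ _)
  have low : ∀ {u v : P2}, u.totalDegree ≤ M → v.totalDegree < M →
      (C 2 * (u * v) + v ^ 2).totalDegree < 2 * M := by
    intro u v hu hv
    refine (totalDegree_add _ _).trans_lt (max_lt ?_ ?_)
    · refine (totalDegree_C_mul_le _ _).trans_lt ((totalDegree_mul _ _).trans_lt ?_); omega
    · refine (totalDegree_pow _ _).trans_lt ?_; omega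
  have hpM := hph.totalDegree_le
  have hqM := hqh.totalDegree_le
  have hlow : (p ^ 2 + q ^ 2).totalDegree < 2 * M := by
    have e : p ^ 2 + q ^ 2 = (f ^ 2 + g ^ 2) -
        ((C 2 * (p * r) + r ^ 2) + (C 2 * (q * s) + s ^ 2)) := by
      rw [hp, hq]; simp only [C_two]; ring
    rw [e]
    refine (totalDegree_sub _ _).trans_lt (max_lt (by omega) ?_)
    exact (totalDegree_add _ _).trans_lt (max_lt (low hpM hr) (low hqM hs))
  have hhom : (p ^ 2 + q ^ 2).IsHomogeneous (2 * M) := by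
    have h1 := hph.pow 2
    have h2 := hqh.pow 2
    rw [mul_comm] at h1 h2
    exact h1.add h2
  have h0 : p ^ 2 + q ^ 2 = 0 := by
    by_contra hne
    rw [hhom.totalDegree hne] at hlow
    omega
  have hp0 := eq_zero_of_sq_add_sq_eq_zero h0
  have hq0 := eq_zero_of_sq_add_sq_eq_zero (by rwa [add_comm] at h0)
  rw [hp0, zero_add] at hp
  rw [hq0, zero_add] at hq
  rw [← hp] at hr
  rw [← hq] at hs
  omega

/-- `x³ + xy² + ax² + hx + iy + j`. -/
noncomputable def polyA (a h i j : ℝ) : P2 :=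
  X 0 ^ 3 + X 0 * X 1 ^ 2 + C a * X 0 ^ 2 + C h * X 0 + C i * X 1 + C j

/-- `x³ - xy² + ay² + hx + iy + j`. -/
noncomputable def polyB (a h i j : ℝ) : P2 :=
  X 0 ^ 3 - X 0 * X 1 ^ 2 + C a * X 1 ^ 2 + C h * X 0 + C i * X 1 + C j

/-- `x²y + ay² + gx + iy + j`. -/
noncomputable def polyC (a g i j : ℝ) : P2 :=
  X 0 ^ 2 * X 1 + C a * X 1 ^ 2 + C g * X 0 + C i * X 1 + C j

/-- `x³ + bxy + cy² + hx + iy + j`. -/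
noncomputable def polyD (b c h i j : ℝ) : P2 :=
  X 0 ^ 3 + C b * (X 0 * X 1) + C c * X 1 ^ 2 + C h * X 0 + C i * X 1 + C j

lemma one_le_totalDegree_image_X (φ : P2 ≃+* P2) (i : Fin 2) : 1 ≤ (φ (X i)).totalDegree := by
  refine one_le_totalDegree_ringEquiv φ (ne_C_of_ev_ne (x := 0) (y := 0) (u := 1) (v := 1) ?_)
  fin_cases i <;> simp [ev]

lemma polyA_affEquiv {a h i j : ℝ} {g : P2} (hg : g.totalDegree = 3)
    (H : AutEquiv (polyA a h i j) g) : AffEquiv (polyA a h i j) g := by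
  obtain ⟨φ, c, hc, H⟩ := H
  have hF := one_le_totalDegree_image_X φ 0
  have hG := one_le_totalDegree_image_X φ 1
  have hsq := totalDegree_sq_add_sq (g := φ (X 1)) hF
  have key : φ (polyA a h i j) = φ (X 0) * (φ (X 0) ^ 2 + φ (X 1) ^ 2) +
      (C a * φ (X 0) ^ 2 + C 0 * φ (X 1) ^ 2 + (C h * φ (X 0) + C i * φ (X 1) + C j)) := by
    simp only [polyA, map_add, map_mul, map_pow, ringEquiv_C, map_zero]; ring
  have hq := totalDegree_quadratic_le (le_max_left (φ (X 0)).totalDegree (φ (X 1)).totalDegree)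
    (le_max_right _ _) a 0 h i j
  have hmul := totalDegree_mul_of_pos hF (g := φ (X 0) ^ 2 + φ (X 1) ^ 2) (by omega)
  have hdeg := congrArg totalDegree key
  rw [totalDegree_add_of_lt (by omega), H, totalDegree_C_mul_of_ne_zero hc, hg] at hdeg
  exact ⟨φ, by omega, by omega, c, hc, H⟩

lemma polyB_affEquiv {a h i j : ℝ} {g : P2} (hg : g.totalDegree = 3)
    (H : AutEquiv (polyB a h i j) g) : AffEquiv (polyB a h i j) g := by
  obtain ⟨φ, c, hc, H⟩ := H
  have hF := one_le_totalDegree_image_X φ 0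
  have hG := one_le_totalDegree_image_X φ 1
  have hU : 1 ≤ (φ (X 0 - X 1)).totalDegree :=
    one_le_totalDegree_ringEquiv φ (ne_C_of_ev_ne (x := 0) (y := 0) (u := 1) (v := 0) (by simp [ev]))
  have hV : 1 ≤ (φ (X 0 + X 1)).totalDegree :=
    one_le_totalDegree_ringEquiv φ (ne_C_of_ev_ne (x := 0) (y := 0) (u := 1) (v := 0) (by simp [ev]))
  rw [map_sub] at hU
  rw [map_add] at hV
  set F := φ (X 0)
  set G := φ (X 1)
  set U := F - G with hUdef
  set V := F + G with hVdef
  have key : φ (polyB a h i j) = F * (U * V) +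
      (C 0 * F ^ 2 + C a * G ^ 2 + (C h * F + C i * G + C j)) := by
    simp only [polyB, map_add, map_sub, map_mul, map_pow, ringEquiv_C, C_0, F, G, U, V]; ring
  have hq := totalDegree_quadratic_le (le_max_left F.totalDegree G.totalDegree)
    (le_max_right _ _) 0 a h i j
  have hUV := totalDegree_mul_of_pos hU hV
  have hmul := totalDegree_mul_of_pos hF (g := U * V) (by omega)
  have r1 : F.totalDegree ≤ max U.totalDegree V.totalDegree := by
    have : F = C (1 / 2) * (U + V) := by
      have : U + V = C 2 * F := by rw [hUdef, hVdef]; simp only [C_two]; ring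
      rw [this, ← mul_assoc, ← C_mul]; norm_num
    rw [this]
    exact (totalDegree_C_mul_le _ _).trans (totalDegree_add _ _)
  have r2 : G.totalDegree ≤ max F.totalDegree U.totalDegree := by
    have : G = F - U := by rw [hUdef]; ring
    rw [this]
    exact totalDegree_sub _ _
  have r3 : G.totalDegree ≤ max V.totalDegree F.totalDegree := by
    have : G = V - F := by rw [hVdef]; ring
    rw [this]
    exact totalDegree_sub _ _
  have r4 : G.totalDegree ≤ max U.totalDegree V.totalDegree := by
    have : G = C (1 / 2) * (V - U) := by
      have : V - U = C 2 * G := by rw [hUdef, hVdef]; simp only [C_two]; ring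
      rw [this, ← mul_assoc, ← C_mul]; norm_num
    rw [this]
    exact (totalDegree_C_mul_le _ _).trans ((totalDegree_sub _ _).trans (max_comm _ _).le)
  have r5 : F.totalDegree ≤ max U.totalDegree G.totalDegree := by
    have : F = U + G := by rw [hUdef]; ring
    rw [this]
    exact totalDegree_add _ _
  have r6 : F.totalDegree ≤ max V.totalDegree G.totalDegree := by
    have : F = V - G := by rw [hVdef]; ring
    rw [this]
    exact totalDegree_sub _ _
  have hdeg := congrArg totalDegree key
  rw [totalDegree_add_of_lt (by omega), H, totalDegree_C_mul_of_ne_zero hc, hg] at hdeg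
  exact ⟨φ, by change F.totalDegree ≤ 1; omega, by change G.totalDegree ≤ 1; omega, c, hc, H⟩

lemma polyC_zero_affEquiv {h i j : ℝ} {g : P2} (hg : g.totalDegree = 3)
    (H : AutEquiv (polyC 0 h i j) g) : AffEquiv (polyC 0 h i j) g := by
  obtain ⟨φ, c, hc, H⟩ := H
  have hF := one_le_totalDegree_image_X φ 0
  have hG := one_le_totalDegree_image_X φ 1
  have key : φ (polyC 0 h i j) = φ (X 0) * (φ (X 0) * φ (X 1)) +
      (C h * φ (X 0) + C i * φ (X 1) + C j) := by
    simp only [polyC, map_add, map_mul, map_pow, ringEquiv_C, map_zero]; ring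
  have hq := totalDegree_linear_le (le_max_left (φ (X 0)).totalDegree (φ (X 1)).totalDegree)
    (le_max_right _ _) h i j
  have hFG := totalDegree_mul_of_pos hF hG
  have hmul := totalDegree_mul_of_pos hF (g := φ (X 0) * φ (X 1)) (by omega)
  have hdeg := congrArg totalDegree key
  rw [totalDegree_add_of_lt (by omega), H, totalDegree_C_mul_of_ne_zero hc, hg] at hdeg
  exact ⟨φ, by omega, by omega, c, hc, H⟩

/-- The substitution `y ↦ -y - x² - i`. -/
noncomputable def flipHom (i : ℝ) : P2 →ₐ[ℝ] P2 := aeval ![X 0, -X 1 - X 0 ^ 2 - C i]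

lemma flipHom_flipHom (i : ℝ) (f : P2) : flipHom i (flipHom i f) = f := by
  refine ev_ext fun x y => ?_
  simp only [flipHom, ev_aeval]
  congr 1
  · simp [ev]
  · simp [ev]; ring

/-- The involution `y ↦ -y - x² - i` as an automorphism. -/
noncomputable def flipEquiv (i : ℝ) : P2 ≃+* P2 :=
  { (flipHom i : P2 →+* P2) with
    invFun := flipHom i
    left_inv := flipHom_flipHom i
    right_inv := flipHom_flipHom i }

lemma flipEquiv_apply (i : ℝ) (f : P2) : flipEquiv i f = flipHom i f := rfl

lemma flipEquiv_polyC (h i j : ℝ) : flipEquiv i (polyC 1 h i j) = polyC 1 h i j := by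
  simp only [flipEquiv_apply, polyC, flipHom, map_add, map_mul, map_pow, aeval_X, algHom_C,
    Matrix.cons_val_zero, Matrix.cons_val_one, algebraMap_eq, map_one]
  ring

lemma polyC_one_affEquiv {h i j : ℝ} {g : P2} (hg : g.totalDegree = 3)
    (H : AutEquiv (polyC 1 h i j) g) : AffEquiv (polyC 1 h i j) g := by
  obtain ⟨φ, c, hc, H⟩ := H
  have hF := one_le_totalDegree_image_X φ 0
  have hG := one_le_totalDegree_image_X φ 1
  have hflip0 : (flipEquiv i).trans φ (X 0) = φ (X 0) := by
    simp [flipEquiv_apply, flipHom]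
  have hflip1 : (flipEquiv i).trans φ (X 1) = -φ (X 1) - φ (X 0) ^ 2 - C i := by
    simp [flipEquiv_apply, flipHom, ringEquiv_C]
  have hK := one_le_totalDegree_image_X ((flipEquiv i).trans φ) 1
  have hH : (flipEquiv i).trans φ (polyC 1 h i j) = C c * g := by
    rw [RingEquiv.trans_apply, flipEquiv_polyC, H]
  have key : φ (polyC 1 h i j) = C (-1) * (φ (X 1) * (flipEquiv i).trans φ (X 1)) +
      (C h * φ (X 0) + C 0 * φ (X 0) + C j) := by
    rw [hflip1]
    simp only [polyC, map_add, map_mul, map_pow, ringEquiv_C, C_0, C_neg, map_one]; ring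
  have hs : 2 * (φ (X 0)).totalDegree ≤
      max (φ (X 1)).totalDegree ((flipEquiv i).trans φ (X 1)).totalDegree := by
    have e : φ (X 0) * φ (X 0) =
        (-φ (X 1) - (flipEquiv i).trans φ (X 1)) - C i := by rw [hflip1]; ring
    have h2 := totalDegree_mul_of_pos hF hF
    rw [e] at h2
    have h3 := totalDegree_sub_C_le (-φ (X 1) - (flipEquiv i).trans φ (X 1)) i
    have h4 := totalDegree_sub (-φ (X 1)) ((flipEquiv i).trans φ (X 1))
    rw [totalDegree_neg] at h4
    omega
  set K := (flipEquiv i).trans φ (X 1)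
  have hq := totalDegree_linear_le (le_refl (φ (X 0)).totalDegree) le_rfl h 0 j
  have hmul := totalDegree_mul_of_pos hG hK
  have hmul' := totalDegree_C_mul_of_ne_zero (c := -1) (by norm_num) (φ (X 1) * K)
  have hdeg := congrArg totalDegree key
  rw [totalDegree_add_of_lt (by omega), H, totalDegree_C_mul_of_ne_zero hc, hg] at hdeg
  rcases Nat.lt_or_ge (φ (X 1)).totalDegree 2 with h1 | h1
  · exact ⟨φ, by omega, by omega, c, hc, H⟩
  · exact ⟨(flipEquiv i).trans φ, by rw [hflip0]; omega, by change K.totalDegree ≤ 1; omega, c, hc, hH⟩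

lemma totalDegree_pderiv_lt {f : P2} (hf : 1 ≤ f.totalDegree) (i : Fin 2) :
    (pderiv i f).totalDegree < f.totalDegree := by
  rw [totalDegree, Finset.sup_lt_iff (by exact hf)]
  intro m hm
  rw [mem_support_iff, coeff_pderiv] at hm
  have h1 := le_totalDegree (mem_support_iff.mpr (left_ne_zero_of_mul hm))
  rw [Finsupp.sum_add_index' (fun _ => rfl) (fun _ _ _ => rfl), Finsupp.sum_single_index rfl] at h1
  omega

/-- The Jacobian determinant of a pair of polynomials. -/
noncomputable def jac (u v : P2) : P2 := pderiv 0 u * pderiv 1 v - pderiv 1 u * pderiv 0 v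

lemma totalDegree_jac_add_two_le {u v : P2} (hu : 1 ≤ u.totalDegree) (hv : 1 ≤ v.totalDegree) :
    (jac u v).totalDegree + 2 ≤ u.totalDegree + v.totalDegree := by
  have h1 := totalDegree_sub (pderiv 0 u * pderiv 1 v) (pderiv 1 u * pderiv 0 v)
  have h2 := totalDegree_mul (pderiv 0 u) (pderiv 1 v)
  have h3 := totalDegree_mul (pderiv 1 u) (pderiv 0 v)
  have h4 := totalDegree_pderiv_lt hu 0
  have h5 := totalDegree_pderiv_lt hu 1
  have h6 := totalDegree_pderiv_lt hv 0
  have h7 := totalDegree_pderiv_lt hv 1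
  rw [jac]
  omega

lemma pderiv_ringEquiv (φ : P2 ≃+* P2) (i : Fin 2) (f : P2) :
    pderiv i (φ f) = φ (pderiv 0 f) * pderiv i (φ (X 0)) + φ (pderiv 1 f) * pderiv i (φ (X 1)) := by
  induction f using MvPolynomial.induction_on with
  | C r => simp [ringEquiv_C]
  | add p q hp hq => simp only [map_add, hp, hq]; ring
  | mul_X p j hp =>
    fin_cases j
    · simp [hp]; ring
    · simp [hp]; ring

lemma jac_ringEquiv (φ : P2 ≃+* P2) (u v : P2) :
    jac (φ u) (φ v) = φ (jac u v) * jac (φ (X 0)) (φ (X 1)) := by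
  simp only [jac, pderiv_ringEquiv φ _ u, pderiv_ringEquiv φ _ v, map_sub, map_mul]
  ring

lemma exists_jac_eq_C (φ : P2 ≃+* P2) : ∃ k : ℝ, k ≠ 0 ∧ jac (φ (X 0)) (φ (X 1)) = C k := by
  have h1 : jac (φ (φ.symm (X 0))) (φ (φ.symm (X 1))) = 1 := by
    simp [jac]
  rw [jac_ringEquiv] at h1
  obtain ⟨k, hk, h⟩ := MvPolynomial.isUnit_iff_eq_C_of_isReduced.mp (IsUnit.of_mul_eq_one_right _ h1)
  exact ⟨k, hk.ne_zero, h⟩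

lemma totalDegree_le_two_of_ev {f : P2} {a b c d e k : ℝ}
    (h : ∀ x y, ev f x y = a * x ^ 2 + b * (x * y) + c * y ^ 2 + d * x + e * y + k) :
    f.totalDegree ≤ 2 := by
  have hf : f = (C a * X 0 ^ 2 + C c * X 1 ^ 2 + (C d * X 0 + C e * X 1 + C k)) +
      C b * (X 0 * X 1) := by
    refine ev_ext fun x y => ?_
    rw [h]; simp [ev]; ring
  have h2 : (C b * (X 0 * X 1) : P2).totalDegree ≤ 2 := by
    refine (totalDegree_C_mul_le _ _).trans ((totalDegree_mul _ _).trans ?_)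
    simp
  rw [hf]
  exact (totalDegree_add _ _).trans
    (max_le (totalDegree_quadratic_le (M := 1) (by simp) (by simp) a c d e k) h2)

lemma totalDegree_le_one_of_ev {f : P2} {d e k : ℝ} (h : ∀ x y, ev f x y = d * x + e * y + k) :
    f.totalDegree ≤ 1 := by
  have hf : f = C d * X 0 + C e * X 1 + C k := by
    refine ev_ext fun x y => ?_
    rw [h]; simp [ev]
  rw [hf]
  exact totalDegree_linear_le (by simp) (by simp) d e k

/-- No polynomial automorphism of the plane has degrees `2` and `3`. -/
lemma jac_ne_C_of_degrees {F G : P2} {κ : ℝ} (hκ : κ ≠ 0) (hJ : jac F G = C κ)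
    (hF : F.totalDegree = 2) (hG : G.totalDegree = 3) : False := by
  obtain ⟨a, b, c, d, e, k, hFe⟩ := ev_quadratic hF.le
  obtain ⟨g₁, g₂, g₃, g₄, s, t, u, v, w, z, hGe⟩ := ev_cubic hG.le
  have hFX : F = C a * X 0 ^ 2 + C b * (X 0 * X 1) + C c * X 1 ^ 2 + C d * X 0 + C e * X 1 + C k := by
    refine ev_ext fun x y => ?_
    rw [hFe]; simp [ev]
  have hGX : G = C g₁ * X 0 ^ 3 + C g₂ * (X 0 ^ 2 * X 1) + C g₃ * (X 0 * X 1 ^ 2) +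
      C g₄ * X 1 ^ 3 + (C s * X 0 ^ 2 + C t * (X 0 * X 1) + C u * X 1 ^ 2 + C v * X 0 +
      C w * X 1 + C z) := by
    refine ev_ext fun x y => ?_
    rw [hGe]; simp [ev]
  have hJe : ∀ x y : ℝ, (2 * a * x + b * y + d) * (g₂ * x ^ 2 + 2 * g₃ * x * y + 3 * g₄ * y ^ 2 +
      t * x + 2 * u * y + w) - (b * x + 2 * c * y + e) * (3 * g₁ * x ^ 2 + 2 * g₂ * x * y +
      g₃ * y ^ 2 + 2 * s * x + t * y + v) = κ := by
    intro x y
    have := congrArg (fun r => ev r x y) hJ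
    rw [hFX, hGX] at this
    simp [jac, ev, Derivation.leibniz_pow] at this
    linear_combination this
  by_cases hdet : 4 * a * c - b ^ 2 = 0
  swap
  · obtain ⟨m, hm⟩ : ∃ m, (4 * a * c - b ^ 2) * m = 1 := ⟨_, mul_inv_cancel₀ hdet⟩
    have := hJe ((b * e - 2 * c * d) * m) ((b * d - 2 * a * e) * m)
    have z1 : 2 * a * ((b * e - 2 * c * d) * m) + b * ((b * d - 2 * a * e) * m) + d = 0 := by
      linear_combination (-d) * hm
    have z2 : b * ((b * e - 2 * c * d) * m) + 2 * c * ((b * d - 2 * a * e) * m) + e = 0 := by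
      linear_combination (-e) * hm
    rw [z1, z2] at this
    apply hκ; linarith
  obtain ⟨⟨e30, e21, e12, e03⟩, e20, e11, e02, e10, e01, e00⟩ := cubic_coeff_eq_zero
    (c₁ := 2 * a * g₂ - 3 * b * g₁) (c₂ := 4 * a * g₃ + b * g₂ - 2 * b * g₂ - 6 * c * g₁)
    (c₃ := 6 * a * g₄ + 2 * b * g₃ - b * g₃ - 4 * c * g₂) (c₄ := 3 * b * g₄ - 2 * c * g₃)
    (a := 2 * a * t + d * g₂ - 2 * b * s - 3 * e * g₁)
    (b := 4 * a * u + b * t + 2 * d * g₃ - b * t - 4 * c * s - 2 * e * g₂)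
    (c := 2 * b * u + 3 * d * g₄ - 2 * c * t - e * g₃)
    (d := 2 * a * w + d * t - b * v - 2 * e * s)
    (e := b * w + 2 * d * u - 2 * c * v - e * t) (k := d * w - e * v - κ)
    (fun x y => by linear_combination hJe x y)
  have hcub : g₁ = 0 → g₂ = 0 → g₃ = 0 → g₄ = 0 → False := by
    rintro rfl rfl rfl rfl
    have := totalDegree_le_two_of_ev (f := G) (a := s) (b := t) (c := u) (d := v) (e := w)
      (k := z) (fun x y => by rw [hGe x y]; ring)
    omega
  by_cases ha : a = 0
  · subst ha
    have hb : b = 0 := by nlinarith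
    subst hb
    have hc : c ≠ 0 := by
      rintro rfl
      have := totalDegree_le_one_of_ev (f := F) (d := d) (e := e) (k := k)
        (fun x y => by rw [hFe x y]; ring)
      omega
    have h1 : g₁ = 0 := by apply mul_left_cancel₀ hc; linarith
    have h2 : g₂ = 0 := by apply mul_left_cancel₀ hc; linarith
    have h3 : g₃ = 0 := by apply mul_left_cancel₀ hc; linarith
    subst h1 h2 h3
    have hs : s = 0 := by apply mul_left_cancel₀ hc; linarith
    subst hs
    have hd : d ≠ 0 := by
      rintro rfl
      have ht : t = 0 := by apply mul_left_cancel₀ hc; linarith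
      subst ht
      have hv : v = 0 := by apply mul_left_cancel₀ hc; linarith
      subst hv
      apply hκ; linarith
    have ht : t = 0 := by apply mul_left_cancel₀ hd; linarith
    subst ht
    exact hcub rfl rfl rfl (by apply mul_left_cancel₀ hd; linarith)
  · obtain ⟨r, rfl⟩ : ∃ r, b = 2 * a * r := ⟨b / (2 * a), by field_simp⟩
    obtain rfl : c = a * r ^ 2 := by
      apply mul_left_cancel₀ ha; linarith
    have h2 : g₂ = 3 * r * g₁ := by apply mul_left_cancel₀ ha; linarith
    subst h2
    have h3 : g₃ = 3 * r ^ 2 * g₁ := by apply mul_left_cancel₀ ha; linarith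
    subst h3
    have h4 : g₄ = r ^ 3 * g₁ := by apply mul_left_cancel₀ ha; linarith
    subst h4
    have h5 : 2 * a * (t - 2 * r * s) = 3 * g₁ * (e - d * r) := by linarith
    have h6 : 2 * a * (2 * u - r * t) = 3 * g₁ * r * (e - d * r) := by linear_combination e11 - r * h5
    have hw : e - d * r ≠ 0 := by
      intro h0
      rw [h0] at h5 h6
      have h7 : t - 2 * r * s = 0 := by apply mul_left_cancel₀ ha; linarith
      have h8 : w - r * v = 0 := by
        apply mul_left_cancel₀ ha
        linear_combination (1 / 2) * e10 - (d / 2) * h7 + s * h0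
      apply hκ
      linear_combination d * h8 - e00 - v * h0
    have h9 : g₁ * (e - d * r) ^ 2 = 0 := by
      linear_combination (2 * a * (-e01 + r * e10) + d * h6 - e * h5) / 3
    have h1 : g₁ = 0 := by simpa [hw] using h9
    subst h1
    exact hcub rfl (by ring) (by ring) (by ring)

lemma weierstrass_affEquiv {h j : ℝ} {g : P2} (hg : g.totalDegree = 3)
    (H : AutEquiv (polyD 0 (-1) h 0 j) g) : AffEquiv (polyD 0 (-1) h 0 j) g := by
  obtain ⟨φ, c, hc, H⟩ := H
  have hF := one_le_totalDegree_image_X φ 0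
  have hG := one_le_totalDegree_image_X φ 1
  obtain ⟨κ, hκ, hJ⟩ := exists_jac_eq_C φ
  have hcg := totalDegree_C_mul_of_ne_zero hc g
  rw [hg] at hcg
  have j1 : jac (φ (X 0)) (C c * g) = C (-2 * κ) * φ (X 1) := by
    rw [← H, jac_ringEquiv, hJ]
    simp [jac, polyD, Derivation.leibniz_pow]
    simp only [map_ofNat]
    ring
  have j2 : jac (C c * g) (φ (X 1)) = C κ * (C 3 * (φ (X 0) * φ (X 0)) + C h) := by
    rw [← H, jac_ringEquiv, hJ]
    simp [jac, polyD, Derivation.leibniz_pow, ringEquiv_C]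
    simp only [map_ofNat]
    ring
  have d1 := totalDegree_jac_add_two_le hF (v := C c * g) (by omega)
  have d2 := totalDegree_jac_add_two_le (u := C c * g) (by omega) hG
  rw [j1, totalDegree_C_mul_of_ne_zero (by simpa using hκ)] at d1
  have hFF := totalDegree_mul_of_pos hF hF
  have hFF3 := totalDegree_C_mul_of_ne_zero (c := 3) (by norm_num) (φ (X 0) * φ (X 0))
  rw [j2, totalDegree_C_mul_of_ne_zero hκ,
    totalDegree_add_of_lt (by rw [totalDegree_C]; omega)] at d2
  have hm : (φ (X 0)).totalDegree ≤ 1 := by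
    by_contra hm
    exact jac_ne_C_of_degrees hκ hJ (by omega) (by omega)
  refine ⟨φ, hm, ?_, c, hc, H⟩
  by_contra hn
  have key : φ (polyD 0 (-1) h 0 j) = C (-1) * (φ (X 1) * φ (X 1)) +
      (φ (X 0) ^ 3 + C h * φ (X 0) + C j) := by
    simp only [polyD, map_add, map_mul, map_pow, ringEquiv_C, map_neg, map_one, map_zero]
    ring
  have hlow : (φ (X 0) ^ 3 + C h * φ (X 0) + C j).totalDegree ≤ 3 := by
    refine (totalDegree_add _ _).trans (max_le ((totalDegree_add _ _).trans (max_le ?_ ?_)) (by simp))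
    · exact (totalDegree_pow _ _).trans (by omega)
    · exact (totalDegree_C_mul_le _ _).trans (by omega)
  have hGG := totalDegree_mul_of_pos hG hG
  have hGG' := totalDegree_C_mul_of_ne_zero (c := -1) (by norm_num) (φ (X 1) * φ (X 1))
  have hdeg := congrArg totalDegree key
  rw [totalDegree_add_of_lt (by omega), H] at hdeg
  omega

lemma univariate_affRel {h j : ℝ} {g : P2} (hg : g.totalDegree = 3)
    (H : AutEquiv (polyD 0 0 h 0 j) g) : AffRel (polyD 0 0 h 0 j) g := by
  obtain ⟨φ, c, hc, H⟩ := H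
  have hF := one_le_totalDegree_image_X φ 0
  have hcg := totalDegree_C_mul_of_ne_zero hc g
  have key : φ (polyD 0 0 h 0 j) = φ (X 0) * (φ (X 0) * φ (X 0)) + (C h * φ (X 0) + C 0 * φ (X 0) + C j) := by
    simp only [polyD, map_add, map_mul, map_pow, ringEquiv_C, map_zero]
    ring
  have hFF := totalDegree_mul_of_pos hF hF
  have hFFF := totalDegree_mul_of_pos hF (g := φ (X 0) * φ (X 0)) (by omega)
  have hlow := totalDegree_linear_le (le_refl (φ (X 0)).totalDegree) le_rfl h 0 j
  have hdeg := congrArg totalDegree key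
  rw [totalDegree_add_of_lt (by omega), H] at hdeg
  obtain ⟨a, b, p, hab⟩ := ev_linear (f := φ (X 0)) (by omega)
  refine ⟨a, b, p, -b, a, 0, c, fun h0 => ?_, hc, fun x y => ?_⟩
  · have ha : a = 0 := by nlinarith [sq_nonneg a, sq_nonneg b]
    have hb : b = 0 := by nlinarith [sq_nonneg a, sq_nonneg b]
    subst ha hb
    have : φ (X 0) = C p := ev_ext fun x y => by rw [hab]; simp [ev]
    rw [this, totalDegree_C] at hF
    omega
  · have := congrArg (fun r => ev r x y) H
    rw [ev_ringEquiv, hab] at this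
    have e : ∀ u v w : ℝ, ev (polyD 0 0 h 0 j) u v = ev (polyD 0 0 h 0 j) u w := by
      intro u v w; simp [ev, polyD]
    rw [e _ _ (ev (φ (X 1)) x y), this]
    simp [ev]

/-- The bivariate cubic with the given coefficients, from the leading form down to the constant. -/
noncomputable def cubic (l₁ l₂ l₃ l₄ s t u v w z : ℝ) : P2 :=
  C l₁ * X 0 ^ 3 + C l₂ * (X 0 ^ 2 * X 1) + C l₃ * (X 0 * X 1 ^ 2) + C l₄ * X 1 ^ 3 +
    (C s * X 0 ^ 2 + C t * (X 0 * X 1) + C u * X 1 ^ 2 + C v * X 0 + C w * X 1 + C z)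

lemma ev_cubic_poly (l₁ l₂ l₃ l₄ s t u v w z x y : ℝ) :
    ev (cubic l₁ l₂ l₃ l₄ s t u v w z) x y =
      l₁ * x ^ 3 + l₂ * (x ^ 2 * y) + l₃ * (x * y ^ 2) + l₄ * y ^ 3 +
        (s * x ^ 2 + t * (x * y) + u * y ^ 2 + v * x + w * y + z) := by
  simp [ev, cubic]

lemma exists_eq_cubic {f : P2} (h : f.totalDegree ≤ 3) :
    ∃ l₁ l₂ l₃ l₄ s t u v w z, f = cubic l₁ l₂ l₃ l₄ s t u v w z := by
  obtain ⟨l₁, l₂, l₃, l₄, s, t, u, v, w, z, h⟩ := ev_cubic h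
  exact ⟨l₁, l₂, l₃, l₄, s, t, u, v, w, z, ev_ext fun x y => by rw [h, ev_cubic_poly]⟩

lemma totalDegree_cubic_le_two (s t u v w z : ℝ) : (cubic 0 0 0 0 s t u v w z).totalDegree ≤ 2 :=
  totalDegree_le_two_of_ev (a := s) (b := t) (c := u) (d := v) (e := w) (k := z)
    fun x y => by rw [ev_cubic_poly]; ring

lemma totalDegree_cubic_le (l₁ l₂ l₃ l₄ s t u v w z : ℝ) :
    (cubic l₁ l₂ l₃ l₄ s t u v w z).totalDegree ≤ 3 := by
  have e : cubic l₁ l₂ l₃ l₄ s t u v w z = X 0 * cubic 0 0 0 0 l₁ l₂ l₃ s t v +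
      X 1 * cubic 0 0 0 0 0 0 l₄ 0 u w + C z := by
    refine ev_ext fun x y => ?_
    simp [ev, cubic]
    ring
  have h1 := totalDegree_mul (X 0) (cubic 0 0 0 0 l₁ l₂ l₃ s t v)
  have h2 := totalDegree_mul (X 1) (cubic 0 0 0 0 0 0 l₄ 0 u w)
  have h3 := totalDegree_cubic_le_two l₁ l₂ l₃ s t v
  have h4 := totalDegree_cubic_le_two 0 0 l₄ 0 u w
  rw [totalDegree_X] at h1 h2
  rw [e]
  exact (totalDegree_add _ _).trans
    (max_le ((totalDegree_add _ _).trans (max_le (by omega) (by omega))) (by simp))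

lemma totalDegree_cubic {l₁ l₂ l₃ l₄ : ℝ} (hl : ¬(l₁ = 0 ∧ l₂ = 0 ∧ l₃ = 0 ∧ l₄ = 0))
    (s t u v w z : ℝ) : (cubic l₁ l₂ l₃ l₄ s t u v w z).totalDegree = 3 := by
  refine le_antisymm (totalDegree_cubic_le ..) ?_
  by_contra hlt
  obtain ⟨a, b, c, d, e, k, h⟩ := ev_quadratic (f := cubic l₁ l₂ l₃ l₄ s t u v w z) (by omega)
  refine hl (cubic_coeff_eq_zero (c₁ := l₁) (c₂ := l₂) (c₃ := l₃) (c₄ := l₄) (a := s - a)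
    (b := t - b) (c := u - c) (d := v - d) (e := w - e) (k := z - k) fun x y => ?_).1
  have := h x y
  rw [ev_cubic_poly] at this
  linear_combination this

lemma polyA_eq_cubic (a h i j : ℝ) : polyA a h i j = cubic 1 0 1 0 a 0 0 h i j := by
  simp [polyA, cubic]; ring

lemma polyB_eq_cubic (a h i j : ℝ) : polyB a h i j = cubic 1 0 (-1) 0 0 0 a h i j := by
  simp [polyB, cubic]; ring

lemma polyC_eq_cubic (a h i j : ℝ) : polyC a h i j = cubic 0 1 0 0 0 0 a h i j := by
  simp [polyC, cubic]; ring

lemma polyD_eq_cubic (b c h i j : ℝ) : polyD b c h i j = cubic 1 0 0 0 0 b c h i j := by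
  simp [polyD, cubic]; ring

lemma totalDegree_polyA (a h i j : ℝ) : (polyA a h i j).totalDegree = 3 := by
  rw [polyA_eq_cubic]; exact totalDegree_cubic (by simp) ..

lemma totalDegree_polyB (a h i j : ℝ) : (polyB a h i j).totalDegree = 3 := by
  rw [polyB_eq_cubic]; exact totalDegree_cubic (by simp) ..

lemma totalDegree_polyC (a h i j : ℝ) : (polyC a h i j).totalDegree = 3 := by
  rw [polyC_eq_cubic]; exact totalDegree_cubic (by simp) ..

lemma totalDegree_polyD (b c h i j : ℝ) : (polyD b c h i j).totalDegree = 3 := by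
  rw [polyD_eq_cubic]; exact totalDegree_cubic (by simp) ..

/-- Coefficient form of an affine substitution between cubics. -/
lemma AffRel.coeffs {l₁ l₂ l₃ l₄ s t u v w z l₁' l₂' l₃' l₄' s' t' u' v' w' z' : ℝ}
    (h : AffRel (cubic l₁ l₂ l₃ l₄ s t u v w z) (cubic l₁' l₂' l₃' l₄' s' t' u' v' w' z')) :
    ∃ a b p c d q k : ℝ, a * d - b * c ≠ 0 ∧ k ≠ 0 ∧
      (l₁ * a ^ 3 + l₂ * a ^ 2 * c + l₃ * a * c ^ 2 + l₄ * c ^ 3 = k * l₁' ∧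
      3 * l₁ * a ^ 2 * b + l₂ * (a ^ 2 * d + 2 * a * b * c) + l₃ * (2 * a * c * d + b * c ^ 2) +
        3 * l₄ * c ^ 2 * d = k * l₂' ∧
      3 * l₁ * a * b ^ 2 + l₂ * (2 * a * b * d + b ^ 2 * c) + l₃ * (a * d ^ 2 + 2 * b * c * d) +
        3 * l₄ * c * d ^ 2 = k * l₃' ∧
      l₁ * b ^ 3 + l₂ * b ^ 2 * d + l₃ * b * d ^ 2 + l₄ * d ^ 3 = k * l₄') ∧
      3 * l₁ * a ^ 2 * p + l₂ * (a ^ 2 * q + 2 * a * c * p) + l₃ * (2 * a * c * q + c ^ 2 * p) +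
        3 * l₄ * c ^ 2 * q + s * a ^ 2 + t * a * c + u * c ^ 2 = k * s' ∧
      6 * l₁ * a * b * p + l₂ * (2 * a * b * q + 2 * p * (a * d + b * c)) +
        l₃ * (2 * q * (a * d + b * c) + 2 * p * c * d) + 6 * l₄ * c * d * q + 2 * s * a * b +
        t * (a * d + b * c) + 2 * u * c * d = k * t' ∧
      3 * l₁ * b ^ 2 * p + l₂ * (b ^ 2 * q + 2 * b * d * p) + l₃ * (2 * b * d * q + d ^ 2 * p) +
        3 * l₄ * d ^ 2 * q + s * b ^ 2 + t * b * d + u * d ^ 2 = k * u' ∧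
      3 * l₁ * a * p ^ 2 + l₂ * (2 * a * p * q + c * p ^ 2) + l₃ * (a * q ^ 2 + 2 * c * p * q) +
        3 * l₄ * c * q ^ 2 + 2 * s * a * p + t * (a * q + c * p) + 2 * u * c * q + v * a + w * c =
        k * v' ∧
      3 * l₁ * b * p ^ 2 + l₂ * (2 * b * p * q + d * p ^ 2) + l₃ * (b * q ^ 2 + 2 * d * p * q) +
        3 * l₄ * d * q ^ 2 + 2 * s * b * p + t * (b * q + d * p) + 2 * u * d * q + v * b + w * d =
        k * w' ∧
      l₁ * p ^ 3 + l₂ * p ^ 2 * q + l₃ * p * q ^ 2 + l₄ * q ^ 3 + s * p ^ 2 + t * p * q +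
        u * q ^ 2 + v * p + w * q + z = k * z' := by
  obtain ⟨a, b, p, c, d, q, k, hdet, hk, h⟩ := h
  refine ⟨a, b, p, c, d, q, k, hdet, hk, ?_⟩
  simp only [← sub_eq_zero (b := k * _)]
  refine cubic_coeff_eq_zero fun x y => ?_
  have := h x y
  rw [ev_cubic_poly, ev_cubic_poly] at this
  linear_combination this

/-- The discriminant of a binary cubic form. -/
def disc (l₁ l₂ l₃ l₄ : ℝ) : ℝ :=
  l₂ ^ 2 * l₃ ^ 2 - 4 * l₁ * l₃ ^ 3 - 4 * l₂ ^ 3 * l₄ + 18 * l₁ * l₂ * l₃ * l₄ -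
    27 * l₁ ^ 2 * l₄ ^ 2

lemma AffRel.disc {l₁ l₂ l₃ l₄ s t u v w z l₁' l₂' l₃' l₄' s' t' u' v' w' z' : ℝ}
    (h : AffRel (cubic l₁ l₂ l₃ l₄ s t u v w z) (cubic l₁' l₂' l₃' l₄' s' t' u' v' w' z')) :
    ∃ r : ℝ, 0 < r ∧ disc l₁ l₂ l₃ l₄ = r * disc l₁' l₂' l₃' l₄' := by
  obtain ⟨a, b, p, c, d, q, k, hdet, hk, ⟨h1, h2, h3, h4⟩, -⟩ := h.coeffs
  refine ⟨k ^ 4 / (a * d - b * c) ^ 6, by positivity, ?_⟩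
  have e : _root_.disc l₁ l₂ l₃ l₄ * (a * d - b * c) ^ 6 = k ^ 4 * _root_.disc l₁' l₂' l₃' l₄' := by
    trans _root_.disc (k * l₁') (k * l₂') (k * l₃') (k * l₄')
    · rw [← h1, ← h2, ← h3, ← h4]; simp only [_root_.disc]; ring
    · simp only [_root_.disc]; ring
  field_simp
  linear_combination e

lemma AffRel.polyA {A H I J A' H' I' J' : ℝ} (h : AffRel (polyA A H I J) (polyA A' H' I' J')) :
    ∃ a d : ℝ, a ≠ 0 ∧ (d = a ∨ d = -a) ∧ A = a * A' ∧ H = a ^ 2 * H' ∧ d * I = a ^ 3 * I' ∧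
      J = a ^ 3 * J' := by
  rw [polyA_eq_cubic, polyA_eq_cubic] at h
  obtain ⟨a, b, p, c, d, q, k, hdet, hk, ⟨h1, h2, h3, h4⟩, hs, ht, hu, hv, hw, hz⟩ := h.coeffs
  obtain rfl : b = 0 := by
    have : b * (b ^ 2 + d ^ 2) = 0 := by linear_combination h4
    rcases mul_eq_zero.mp this with h | h
    · exact h
    · nlinarith [sq_nonneg b, sq_nonneg d]
  have ha : a ≠ 0 := by rintro rfl; simp at hdet
  have hd : d ≠ 0 := by rintro rfl; simp at hdet
  obtain rfl : c = 0 := by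
    have : (a * d) * c = 0 := by linear_combination h2 / 2
    simpa [ha, hd] using this
  obtain rfl : k = a ^ 3 := by linear_combination -h1
  have hda : d ^ 2 = a ^ 2 := by
    apply mul_left_cancel₀ ha; linear_combination h3
  obtain rfl : q = 0 := by
    have : (a * d) * q = 0 := by linear_combination ht / 2
    simpa [ha, hd] using this
  obtain rfl : p = 0 := by
    have : d ^ 2 * p = 0 := by linear_combination hu
    simpa [hd] using this
  refine ⟨a, d, ha, sq_eq_sq_iff_eq_or_eq_neg.mp hda, ?_, ?_, ?_, ?_⟩
  · apply mul_left_cancel₀ (pow_ne_zero 2 ha); linear_combination hs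
  · apply mul_left_cancel₀ ha; linear_combination hv
  · linear_combination hw
  · linear_combination hz

lemma AffRel.polyC {A G I J A' G' I' J' : ℝ} (h : AffRel (polyC A G I J) (polyC A' G' I' J')) :
    ∃ a d : ℝ, a ≠ 0 ∧ d ≠ 0 ∧ A * d = a ^ 2 * A' ∧ G = a * d * G' ∧ I = a ^ 2 * I' ∧
      J = a ^ 2 * d * J' := by
  rw [polyC_eq_cubic, polyC_eq_cubic] at h
  obtain ⟨a, b, p, c, d, q, k, hdet, hk, ⟨h1, h2, h3, h4⟩, hs, ht, hu, hv, hw, hz⟩ := h.coeffs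
  obtain rfl : b = 0 := by
    have h4' : b ^ 2 * d = 0 := by linear_combination h4
    rcases mul_eq_zero.mp h4' with h | h
    · simpa using h
    · subst h
      have : b ^ 2 * c = 0 := by linear_combination h3
      rcases mul_eq_zero.mp this with h | h
      · simpa using h
      · subst h; simp at hdet
  have ha : a ≠ 0 := by rintro rfl; simp at hdet
  have hd : d ≠ 0 := by rintro rfl; simp at hdet
  obtain rfl : c = 0 := by
    have : a ^ 2 * c = 0 := by linear_combination h1
    simpa [ha] using this
  obtain rfl : k = a ^ 2 * d := by linear_combination -h2
  obtain rfl : p = 0 := by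
    have : (a * d) * p = 0 := by linear_combination ht / 2
    simpa [ha, hd] using this
  obtain rfl : q = 0 := by
    have : a ^ 2 * q = 0 := by linear_combination hs
    simpa [ha] using this
  refine ⟨a, d, ha, hd, ?_, ?_, ?_, ?_⟩
  · apply mul_left_cancel₀ hd; linear_combination hu
  · apply mul_left_cancel₀ ha; linear_combination hv
  · apply mul_left_cancel₀ hd; linear_combination hw
  · linear_combination hz

lemma AffRel.polyD {B C H I J B' C' H' I' J' : ℝ}
    (h : AffRel (polyD B C H I J) (polyD B' C' H' I' J')) :
    ∃ a p c d q : ℝ, a ≠ 0 ∧ d ≠ 0 ∧ C * d ^ 2 = a ^ 3 * C' ∧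
      B * a * d + 2 * C * c * d = a ^ 3 * B' ∧ 3 * a ^ 2 * p + B * a * c + C * c ^ 2 = 0 ∧
      3 * a * p ^ 2 + B * (a * q + c * p) + 2 * C * c * q + H * a + I * c = a ^ 3 * H' ∧
      B * p * d + 2 * C * d * q + I * d = a ^ 3 * I' ∧
      p ^ 3 + B * p * q + C * q ^ 2 + H * p + I * q + J = a ^ 3 * J' := by
  rw [polyD_eq_cubic, polyD_eq_cubic] at h
  obtain ⟨a, b, p, c, d, q, k, hdet, hk, ⟨h1, h2, h3, h4⟩, hs, ht, hu, hv, hw, hz⟩ := h.coeffs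
  obtain rfl : b = 0 := by
    have h4' : b ^ 3 = 0 := by linear_combination h4
    simpa using h4'
  have ha : a ≠ 0 := by rintro rfl; simp at hdet
  have hd : d ≠ 0 := by rintro rfl; simp at hdet
  obtain rfl : k = a ^ 3 := by linear_combination -h1
  refine ⟨a, p, c, d, q, ha, hd, ?_, ?_, ?_, ?_, ?_, ?_⟩
  · linear_combination hu
  · linear_combination ht
  · linear_combination hs
  · linear_combination hv
  · linear_combination hw
  · linear_combination hz

lemma not_affRel_polyC_polyD {A H I J B C H' I' J' : ℝ} :
    ¬ AffRel (polyC A H I J) (polyD B C H' I' J') := by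
  intro h
  rw [polyC_eq_cubic, polyD_eq_cubic] at h
  obtain ⟨a, b, p, c, d, q, k, hdet, hk, ⟨h1, h2, h3, h4⟩, -⟩ := h.coeffs
  have h4' : b ^ 2 * d = 0 := by linear_combination h4
  rcases mul_eq_zero.mp h4' with h | h
  · obtain rfl : b = 0 := by simpa using h
    have ha : a ≠ 0 := by rintro rfl; simp at hdet
    have hd : d ≠ 0 := by rintro rfl; simp at hdet
    have : a ^ 2 * d = 0 := by linear_combination h2
    simp [ha, hd] at this
  · subst h
    have hb : b ≠ 0 := by rintro rfl; simp at hdet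
    have hc : c ≠ 0 := by rintro rfl; simp at hdet
    have : b ^ 2 * c = 0 := by linear_combination h3
    simp [hb, hc] at this

lemma not_affRel_polyD_polyC {A H I J B C H' I' J' : ℝ} :
    ¬ AffRel (polyD B C H' I' J') (polyC A H I J) := by
  intro h
  rw [polyC_eq_cubic, polyD_eq_cubic] at h
  obtain ⟨a, b, p, c, d, q, k, hdet, hk, ⟨h1, h2, h3, h4⟩, -⟩ := h.coeffs
  obtain rfl : b = 0 := by
    have : b ^ 3 = 0 := by linear_combination h4
    simpa using this
  apply hk; linear_combination -h2

/-- The affine maps between members of the family `x³ - xy² + ⋯`. -/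
lemma AffRel.polyB {A H I J A' H' I' J' : ℝ} (h : AffRel (polyB A H I J) (polyB A' H' I' J')) :
    ∃ a e : ℝ, a ≠ 0 ∧ (e = a ∨ e = -a) ∧
      ((A = a * A' ∧ H = a ^ 2 * H' ∧ e * I = a ^ 3 * I' ∧ J = a ^ 3 * J') ∨
      ∃ s : ℝ, (s = 1 ∨ s = -1) ∧ A = -2 * a * A' ∧
        9 / 4 * A ^ 2 + H - 3 * s * I = -8 * a ^ 2 * H' ∧
        e * (3 / 4 * A ^ 2 + H + s * I) = -8 * a ^ 3 * I' ∧
        9 / 16 * A ^ 3 + 3 / 4 * A * (H - s * I) + J = -8 * a ^ 3 * J') := by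
  rw [polyB_eq_cubic, polyB_eq_cubic] at h
  obtain ⟨a, b, p, c, d, q, k, hdet, hk, ⟨h1, h2, h3, h4⟩, hs, ht, hu, hv, hw, hz⟩ := h.coeffs
  have h4' : b * ((b - d) * (b + d)) = 0 := by linear_combination h4
  by_cases hb : b = 0
  · subst hb
    have ha : a ≠ 0 := by rintro rfl; simp at hdet
    have hd : d ≠ 0 := by rintro rfl; simp at hdet
    obtain rfl : c = 0 := by
      have : (a * d) * c = 0 := by linear_combination -h2 / 2
      simpa [ha, hd] using this
    obtain rfl : k = a ^ 3 := by linear_combination -h1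
    have hda : d ^ 2 = a ^ 2 := by
      apply mul_left_cancel₀ ha; linear_combination -h3
    obtain rfl : p = 0 := by
      have : a ^ 2 * p = 0 := by linear_combination hs / 3
      simpa [ha] using this
    obtain rfl : q = 0 := by
      have : (a * d) * q = 0 := by linear_combination -ht / 2
      simpa [ha, hd] using this
    refine ⟨a, d, ha, sq_eq_sq_iff_eq_or_eq_neg.mp hda, Or.inl ⟨?_, ?_, ?_, ?_⟩⟩
    · apply mul_left_cancel₀ (pow_ne_zero 2 ha); linear_combination hu - A * hda
    · apply mul_left_cancel₀ ha; linear_combination hv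
    · linear_combination hw
    · linear_combination hz
  · obtain ⟨s, hs1, rfl⟩ : ∃ s : ℝ, (s = 1 ∨ s = -1) ∧ d = s * b := by
      rcases mul_eq_zero.mp ((mul_eq_zero.mp h4').resolve_left hb) with h | h
      · exact ⟨1, Or.inl rfl, by linarith⟩
      · exact ⟨-1, Or.inr rfl, by linarith⟩
    have hss : s ^ 2 = 1 := by rcases hs1 with rfl | rfl <;> norm_num
    have hac : s * a ≠ c := by
      rintro rfl; apply hdet; ring
    have hca : c = -3 * s * a := by
      have : (b * (s * a - c)) * (c + 3 * s * a) = 0 := by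
        linear_combination h2 + 3 * a ^ 2 * b * hss
      rcases mul_eq_zero.mp this with h | h
      · rcases mul_eq_zero.mp h with h | h
        · exact absurd h hb
        · exact absurd (by linarith) hac
      · linarith
    subst hca
    have ha : a ≠ 0 := by rintro rfl; simp at hdet
    have hs0 : s ≠ 0 := by rintro rfl; norm_num at hss
    obtain rfl : k = -8 * a ^ 3 := by linear_combination -h1 - 9 * a ^ 3 * hss
    have hba : b ^ 2 = a ^ 2 := by
      apply mul_left_cancel₀ (mul_ne_zero (by norm_num : (8 : ℝ) ≠ 0) ha)
      linear_combination h3 - 5 * a * b ^ 2 * hss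
    have e1 : a ^ 2 * (-6 * p + 6 * s * q + 9 * A) = 0 := by
      linear_combination hs + 9 * a ^ 2 * (p - A) * hss
    have e2 : (a * b) * (12 * p + 4 * s * q - 6 * A) = 0 := by
      linear_combination ht + 6 * a * b * (A - p) * hss
    have e1' := (mul_eq_zero.mp e1).resolve_left (by simpa using ha)
    have e2' := (mul_eq_zero.mp e2).resolve_left (by simp [ha, hb])
    obtain rfl : p = 3 / 4 * A := by linarith
    obtain rfl : q = -(3 / 4 * A * s) := by
      apply mul_left_cancel₀ hs0; linear_combination e2' / 4 + 3 / 4 * A * hss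
    refine ⟨a, b, ha, sq_eq_sq_iff_eq_or_eq_neg.mp hba, Or.inr ⟨s, hs1, ?_, ?_, ?_, ?_⟩⟩
    · apply mul_left_cancel₀ (pow_ne_zero 2 ha)
      rcases hs1 with rfl | rfl <;> linear_combination hu / 4 - A * hba
    · apply mul_left_cancel₀ ha
      rcases hs1 with rfl | rfl <;> linear_combination hv
    · rcases hs1 with rfl | rfl <;> linear_combination hw
    · rcases hs1 with rfl | rfl <;> linear_combination hz

/-- The parameters of the canonical forms `x³ + xy² + ax² + hx + iy + j`. -/
def ParamA (a h i j : ℝ) : Prop :=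
  (a = 1 ∧ 0 ≤ i) ∨ (a = 0 ∧ i = 1 ∧ 0 ≤ j) ∨ (a = 0 ∧ i = 0 ∧ (h = 1 ∨ h = -1) ∧ 0 ≤ j) ∨
    (a = 0 ∧ i = 0 ∧ h = 0 ∧ (j = 1 ∨ j = 0))

/-- The parameters of the canonical forms `x³ - xy² + ay² + hx + iy + j`. -/
def ParamB (a h i j : ℝ) : Prop :=
  (a = -1 ∧ 0 ≤ i ∧ h + i ≤ -(3 / 4)) ∨ (a = 0 ∧ i = -1 ∧ 0 ≤ j ∧ -1 ≤ h ∧ h ≤ 1) ∨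
    (a = 0 ∧ i = 0 ∧ h = 0 ∧ (j = 1 ∨ j = 0))

/-- The parameters of the canonical forms `x²y + ay² + gx + iy + j`. -/
def ParamC (a g i j : ℝ) : Prop :=
  (a = 1 ∧ g = -1) ∨ (a = 1 ∧ g = 0 ∧ (i = 1 ∨ i = -1)) ∨
    (a = 1 ∧ g = 0 ∧ i = 0 ∧ (j = 1 ∨ j = -1 ∨ j = 0)) ∨
    (a = 0 ∧ g = -1 ∧ (i = 1 ∨ i = -1) ∧ 0 ≤ j) ∨
    (a = 0 ∧ g = 0 ∧ (i = 1 ∨ i = -1) ∧ (j = 1 ∨ j = 0)) ∨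
    (a = 0 ∧ g = -1 ∧ i = 0 ∧ (j = 1 ∨ j = 0)) ∨
    (a = 0 ∧ g = 0 ∧ i = 0 ∧ (j = -1 ∨ j = 0))

/-- The parameters of the canonical forms `x³ + bxy + cy² + hx + iy + j`. -/
def ParamD (b c h i j : ℝ) : Prop :=
  (b = 0 ∧ c = -1 ∧ i = 0 ∧ ((h = 1 ∨ h = -1) ∨ h = 0 ∧ (j = 1 ∨ j = -1 ∨ j = 0))) ∨
    (b = 0 ∧ c = 0 ∧ h = 0 ∧ i = -1 ∧ j = 0) ∨
    (b = -1 ∧ c = 0 ∧ h = 0 ∧ i = 0 ∧ (j = 1 ∨ j = 0)) ∨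
    (b = 0 ∧ c = 0 ∧ i = 0 ∧ ((h = 1 ∨ h = -1) ∧ 0 ≤ j ∨ h = 0 ∧ (j = 1 ∨ j = 0)))

lemma ParamA.famA {a h i j : ℝ} (H : ParamA a h i j) : FamA (polyA a h i j) := by
  unfold FamA
  rcases H with ⟨rfl, hi⟩ | ⟨rfl, rfl, hj⟩ | ⟨rfl, rfl, hh, hj⟩ | ⟨rfl, rfl, rfl, rfl | rfl⟩
  · exact Or.inl ⟨h, i, j, hi, by simp [polyA]⟩
  · exact Or.inr (Or.inl ⟨h, j, hj, by simp [polyA]; ring⟩)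
  · exact Or.inr (Or.inr (Or.inl ⟨h, j, hh, hj, by simp [polyA]⟩))
  all_goals simp [polyA]

lemma FamA.exists_param {p : P2} (H : FamA p) :
    ∃ a h i j, ParamA a h i j ∧ p = polyA a h i j := by
  unfold ParamA
  rcases H with ⟨h, i, j, hi, rfl⟩ | ⟨h, j, hj, rfl⟩ | ⟨h, j, hh, hj, rfl⟩ | rfl | rfl
  · exact ⟨1, h, i, j, by simp [hi], by simp [polyA]⟩
  · exact ⟨0, h, 1, j, by simp [hj], by simp [polyA]; ring⟩
  · exact ⟨0, h, 0, j, by simp [hh, hj], by simp [polyA]⟩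
  · exact ⟨0, 0, 0, 1, by simp, by simp [polyA]⟩
  · exact ⟨0, 0, 0, 0, by simp, by simp [polyA]⟩

lemma ParamB.famB {a h i j : ℝ} (H : ParamB a h i j) : FamB (polyB a h i j) := by
  unfold FamB
  rcases H with ⟨rfl, hi, hhi⟩ | ⟨rfl, rfl, hj, h1, h2⟩ | ⟨rfl, rfl, rfl, rfl | rfl⟩
  · exact Or.inl ⟨h, i, j, hi, hhi, by simp [polyB]; ring⟩
  · exact Or.inr (Or.inl ⟨h, j, hj, h1, h2, by simp [polyB]; ring⟩)
  all_goals simp [polyB]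

lemma FamB.exists_param {p : P2} (H : FamB p) :
    ∃ a h i j, ParamB a h i j ∧ p = polyB a h i j := by
  unfold ParamB
  rcases H with ⟨h, i, j, hi, hhi, rfl⟩ | ⟨h, j, hj, h1, h2, rfl⟩ | rfl | rfl
  · exact ⟨-1, h, i, j, by simp [hi, hhi], by simp [polyB]; ring⟩
  · exact ⟨0, h, -1, j, by simp [hj, h1, h2], by simp [polyB]; ring⟩
  · exact ⟨0, 0, 0, 1, by simp, by simp [polyB]⟩
  · exact ⟨0, 0, 0, 0, by simp, by simp [polyB]⟩

lemma ParamC.famC {a g i j : ℝ} (H : ParamC a g i j) : FamC (polyC a g i j) := by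
  unfold FamC
  rcases H with ⟨rfl, rfl⟩ | ⟨rfl, rfl, hi⟩ | ⟨rfl, rfl, rfl, rfl | rfl | rfl⟩ |
    ⟨rfl, rfl, hi, hj⟩ | ⟨rfl, rfl, hi, rfl | rfl⟩ | ⟨rfl, rfl, rfl, rfl | rfl⟩ |
    ⟨rfl, rfl, rfl, rfl | rfl⟩
  · exact Or.inl ⟨i, j, by simp [polyC]; ring⟩
  · exact Or.inr (Or.inl ⟨i, j, hi, by simp [polyC]⟩)
  · exact Or.inr (Or.inr (Or.inl ⟨1, by simp, by simp [polyC]⟩))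
  · exact Or.inr (Or.inr (Or.inl ⟨-1, by simp, by simp [polyC]⟩))
  · simp [polyC]
  · exact Or.inr (Or.inr (Or.inr (Or.inr (Or.inl ⟨i, j, hi, hj, by simp [polyC]; ring⟩))))
  · exact Or.inr (Or.inr (Or.inr (Or.inr (Or.inr (Or.inl ⟨i, hi, by simp [polyC]⟩)))))
  · exact Or.inr (Or.inr (Or.inr (Or.inr (Or.inr (Or.inr (Or.inl ⟨i, hi, by simp [polyC]⟩))))))
  all_goals simp [polyC, ← sub_eq_add_neg]

lemma FamC.exists_param {p : P2} (H : FamC p) :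
    ∃ a g i j, ParamC a g i j ∧ p = polyC a g i j := by
  unfold ParamC
  rcases H with ⟨i, j, rfl⟩ | ⟨e, j, he, rfl⟩ | ⟨e, he, rfl⟩ | rfl | ⟨e, j, he, hj, rfl⟩ |
    ⟨e, he, rfl⟩ | ⟨e, he, rfl⟩ | rfl | rfl | rfl | rfl
  · exact ⟨1, -1, i, j, by simp, by simp [polyC]; ring⟩
  · exact ⟨1, 0, e, j, by simp [he], by simp [polyC]⟩
  · exact ⟨1, 0, 0, e, by rcases he with rfl | rfl <;> simp, by simp [polyC]⟩
  · exact ⟨1, 0, 0, 0, by simp, by simp [polyC]⟩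
  · exact ⟨0, -1, e, j, by simp [he, hj], by simp [polyC]; ring⟩
  · exact ⟨0, 0, e, 1, by simp [he], by simp [polyC]⟩
  · exact ⟨0, 0, e, 0, by simp [he], by simp [polyC]⟩
  · exact ⟨0, -1, 0, 1, by simp, by simp [polyC]; ring⟩
  · exact ⟨0, -1, 0, 0, by simp, by simp [polyC]; ring⟩
  · exact ⟨0, 0, 0, -1, by simp, by simp [polyC]; ring⟩
  · exact ⟨0, 0, 0, 0, by simp, by simp [polyC]⟩

lemma ParamD.famD {b c h i j : ℝ} (H : ParamD b c h i j) : FamD (polyD b c h i j) := by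
  unfold FamD
  rcases H with ⟨rfl, rfl, rfl, hh | ⟨rfl, rfl | rfl | rfl⟩⟩ | ⟨rfl, rfl, rfl, rfl, rfl⟩ |
    ⟨rfl, rfl, rfl, rfl, rfl | rfl⟩ | ⟨rfl, rfl, rfl, ⟨hh, hj⟩ | ⟨rfl, rfl | rfl⟩⟩
  · exact Or.inl ⟨h, j, hh, by simp [polyD]; ring⟩
  · exact Or.inr (Or.inl ⟨1, by simp, by simp [polyD]; ring⟩)
  · exact Or.inr (Or.inl ⟨-1, by simp, by simp [polyD]; ring⟩)
  · simp [polyD, ← sub_eq_add_neg]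
  · simp [polyD, ← sub_eq_add_neg]
  · simp [polyD, ← sub_eq_add_neg]
  · simp [polyD, ← sub_eq_add_neg]
  · exact Or.inr (Or.inr (Or.inr (Or.inr (Or.inr (Or.inr (Or.inl
      ⟨h, j, hh, hj, by simp [polyD]⟩))))))
  all_goals simp [polyD]

lemma FamD.exists_param {p : P2} (H : FamD p) :
    ∃ b c h i j, ParamD b c h i j ∧ p = polyD b c h i j := by
  unfold ParamD
  rcases H with ⟨e, j, he, rfl⟩ | ⟨e, he, rfl⟩ | rfl | rfl | rfl | rfl | ⟨e, j, he, hj, rfl⟩ |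
    rfl | rfl
  · exact ⟨0, -1, e, 0, j, by simp [he], by simp [polyD]; ring⟩
  · exact ⟨0, -1, 0, 0, e, by rcases he with rfl | rfl <;> simp, by simp [polyD]; ring⟩
  · exact ⟨0, -1, 0, 0, 0, by simp, by simp [polyD]; ring⟩
  · exact ⟨0, 0, 0, -1, 0, by simp, by simp [polyD]; ring⟩
  · exact ⟨-1, 0, 0, 0, 1, by simp, by simp [polyD]; ring⟩
  · exact ⟨-1, 0, 0, 0, 0, by simp, by simp [polyD]; ring⟩
  · exact ⟨0, 0, e, 0, j, by simp [he, hj], by simp [polyD]⟩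
  · exact ⟨0, 0, 0, 0, 1, by simp, by simp [polyD]⟩
  · exact ⟨0, 0, 0, 0, 0, by simp, by simp [polyD]⟩


lemma eq_of_nonneg_of_sq_eq_one {r x y : ℝ} (hr : r ^ 2 = 1) (hx : 0 ≤ x) (hy : 0 ≤ y)
    (h : x = r * y) : x = y := by
  rcases (show r = 1 ∨ r = -1 by simpa using hr) with rfl | rfl <;> linarith

lemma eq_of_sign_eq_mul {e e' R : ℝ} (hR : 0 < R) (he : e = 1 ∨ e = -1) (he' : e' = 1 ∨ e' = -1)
    (h : e = R * e') : R = 1 ∧ e = e' := by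
  rcases he with rfl | rfl <;> rcases he' with rfl | rfl <;> constructor <;> linarith

lemma ParamA.eq_of_affRel {a h i j a' h' i' j' : ℝ} (hP : ParamA a h i j)
    (hP' : ParamA a' h' i' j') (H : AffRel (polyA a h i j) (polyA a' h' i' j')) :
    polyA a h i j = polyA a' h' i' j' := by
  obtain ⟨r, d, hr, hd, h1, h2, h3, h4⟩ := H.polyA
  have hr2 : 0 < r ^ 2 := by positivity
  have h3' : i = r ^ 2 * i' ∨ i = -(r ^ 2 * i') := by
    rcases hd with rfl | rfl
    · exact Or.inl (mul_left_cancel₀ hr (by linear_combination h3))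
    · exact Or.inr (mul_left_cancel₀ hr (by linear_combination -h3))
  suffices a = a' ∧ h = h' ∧ i = i' ∧ j = j' by rw [this.1, this.2.1, this.2.2.1, this.2.2.2]
  have hr3 : r ^ 3 = r * r ^ 2 := by ring
  have hsign := @eq_of_sign_eq_mul h h' (r ^ 2) hr2
  have hunit : r ^ 2 = 1 → r = 1 ∨ r = -1 := fun h => by simpa using h
  have hJ : j = r ^ 3 * j' → r ^ 2 = 1 → 0 ≤ j → 0 ≤ j' → j = j' := fun h h2 hj hj' =>
    eq_of_nonneg_of_sq_eq_one h2 hj hj' (by rw [h]; linear_combination r * j' * h2)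
  have hone : r = 1 → r ^ 2 = 1 := fun h => by rw [h, one_pow]
  rw [hr3] at h3 h4 hJ
  clear hr3
  generalize r ^ 2 = R at *
  rcases hP with ⟨rfl, hi⟩ | ⟨rfl, rfl, hj⟩ | ⟨rfl, rfl, hh, hj⟩ | ⟨rfl, rfl, rfl, hj⟩ <;>
  rcases hP' with ⟨rfl, hi'⟩ | ⟨rfl, rfl, hj'⟩ | ⟨rfl, rfl, hh', hj'⟩ | ⟨rfl, rfl, rfl, hj'⟩ <;>
  grind

lemma ParamB.eq_of_affRel {a h i j a' h' i' j' : ℝ} (hP : ParamB a h i j)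
    (hP' : ParamB a' h' i' j') (H : AffRel (polyB a h i j) (polyB a' h' i' j')) :
    polyB a h i j = polyB a' h' i' j' := by
  obtain ⟨r, d, hr, hd, H⟩ := H.polyB
  suffices a = a' ∧ h = h' ∧ i = i' ∧ j = j' by rw [this.1, this.2.1, this.2.2.1, this.2.2.2]
  have hr2 : 0 < r ^ 2 := by positivity
  have hr3 : r ^ 3 = r * r ^ 2 := by ring
  have hunit : r ^ 2 = 1 → r = 1 ∨ r = -1 := fun h => by simpa using h
  have hJ : j = r ^ 3 * j' → r ^ 2 = 1 → 0 ≤ j → 0 ≤ j' → j = j' := fun h h2 hj hj' =>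
    eq_of_nonneg_of_sq_eq_one h2 hj hj' (by rw [h]; linear_combination r * j' * h2)
  have hone : r = 1 → r ^ 2 = 1 := fun h => by rw [h, one_pow]
  rcases H with ⟨h1, h2, h3, h4⟩ | ⟨s, hs, h1, h2, h3, h4⟩
  · have h3' : i = r ^ 2 * i' ∨ i = -(r ^ 2 * i') := by
      rcases hd with rfl | rfl
      · exact Or.inl (mul_left_cancel₀ hr (by linear_combination h3))
      · exact Or.inr (mul_left_cancel₀ hr (by linear_combination -h3))
    rw [hr3] at h3 h4 hJ
    clear hr3
    generalize r ^ 2 = R at *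
    rcases hP with ⟨rfl, hi, hhi⟩ | ⟨rfl, rfl, hj, hl, hu⟩ | ⟨rfl, rfl, rfl, hj⟩ <;>
    rcases hP' with ⟨rfl, hi', hhi'⟩ | ⟨rfl, rfl, hj', hl', hu'⟩ | ⟨rfl, rfl, rfl, hj'⟩ <;>
    grind
  · have h3' : 3 / 4 * a ^ 2 + h + s * i = -8 * (r ^ 2 * i') ∨
        3 / 4 * a ^ 2 + h + s * i = 8 * (r ^ 2 * i') := by
      rcases hd with rfl | rfl
      · exact Or.inl (mul_left_cancel₀ hr (by linear_combination h3))
      · exact Or.inr (mul_left_cancel₀ hr (by linear_combination -h3))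
    rcases hP with ⟨rfl, hi, hhi⟩ | ⟨rfl, rfl, hj, hl, hu⟩ | ⟨rfl, rfl, rfl, hj⟩ <;>
    rcases hP' with ⟨rfl, hi', hhi'⟩ | ⟨rfl, rfl, hj', hl', hu'⟩ | ⟨rfl, rfl, rfl, hj'⟩
    · obtain rfl : r = -1 / 2 := by linarith
      norm_num at h2 h3' h4
      rcases hs with rfl | rfl <;> rcases h3' with h3' | h3' <;>
        refine ⟨rfl, ?_, ?_, ?_⟩ <;> linarith
    · simp at h1
    · simp at h1
    · exact absurd h1 (by simpa using hr)
    · rw [neg_mul, ← mul_neg, mul_assoc] at h2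
      have hR : r ^ 2 = 1 / 4 ∧ h = h' := by
        generalize r ^ 2 = R at *
        clear hunit hone hJ
        rcases hs with rfl | rfl <;> rcases h3' with h3' | h3' <;> norm_num at h2 h3'
        · linarith
        · obtain rfl : R = 1 / 4 := by nlinarith
          constructor <;> linarith
        · obtain rfl : R = 1 / 4 := by nlinarith
          constructor <;> linarith
        · linarith
      refine ⟨rfl, hR.2, rfl, ?_⟩
      exact eq_of_nonneg_of_sq_eq_one (r := -2 * r) (by linear_combination 4 * hR.1) hj hj'
        (by linear_combination h4 - 8 * r * j' * hR.1)
    · rcases hs with rfl | rfl <;> norm_num at h2 <;> linarith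
    · exact absurd h1 (by simpa using hr)
    · rcases h3' with h | h <;> norm_num at h <;> simp [hr] at h
    · refine ⟨rfl, rfl, rfl, ?_⟩
      rcases hj with rfl | rfl <;> rcases hj' with rfl | rfl <;> simp [hr] at h4 ⊢


lemma ParamC.eq_of_affRel {a g i j a' g' i' j' : ℝ} (hP : ParamC a g i j)
    (hP' : ParamC a' g' i' j') (H : AffRel (polyC a g i j) (polyC a' g' i' j')) :
    polyC a g i j = polyC a' g' i' j' := by
  obtain ⟨r, d, hr, hd, h1, h2, h3, h4⟩ := H.polyC
  suffices a = a' ∧ g = g' ∧ i = i' ∧ j = j' by rw [this.1, this.2.1, this.2.2.1, this.2.2.2]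
  have hr2 : 0 < r ^ 2 := by positivity
  have hsign := @eq_of_sign_eq_mul i i' (r ^ 2) hr2
  have hunit : r ^ 2 = 1 → r = 1 ∨ r = -1 := fun h => by simpa using h
  have ha : ∀ {a g i j}, ParamC a g i j → a = 1 ∨ a = 0 := by
    unfold ParamC; tauto
  have hg : ∀ {a g i j}, ParamC a g i j → g = -1 ∨ g = 0 := by
    unfold ParamC; tauto
  obtain rfl : a = a' := by
    rcases ha hP with rfl | rfl <;> rcases ha hP' with rfl | rfl <;> simp [hd, hr2.ne] at h1 ⊢
  obtain rfl : g = g' := by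
    rcases hg hP with rfl | rfl <;> rcases hg hP' with rfl | rfl <;> simp [hr, hd] at h2 ⊢
  simp only [true_and]
  rcases ha hP with rfl | rfl
  · obtain rfl : d = r ^ 2 := by linarith
    rcases hg hP with rfl | rfl
    · obtain rfl : r = 1 := by
        have : (r - 1) * (r ^ 2 + r + 1) = 0 := by linear_combination h2
        rcases mul_eq_zero.mp this with h | h
        · linarith
        · nlinarith [sq_nonneg (r + 1)]
      constructor <;> linarith
    · have hsign' := @eq_of_sign_eq_mul j j' (r ^ 2 * r ^ 2) (by positivity)
      simp [ParamC] at hP hP'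
      grind
  · rcases hg hP with rfl | rfl
    · obtain rfl : d = r⁻¹ := by
        field_simp; linarith
      have hj : j = r * j' := by rw [h4]; field_simp
      have hJ := fun h => @eq_of_nonneg_of_sq_eq_one r j j' h
      simp [ParamC] at hP hP'
      grind
    · simp [ParamC] at hP hP'
      grind

lemma ParamD.eq_of_affRel {c h j b' c' h' i' j' : ℝ} (hP : ParamD 0 c h 0 j)
    (hP' : ParamD b' c' h' i' j') (H : AffRel (polyD 0 c h 0 j) (polyD b' c' h' i' j')) :
    polyD 0 c h 0 j = polyD b' c' h' i' j' := by
  obtain ⟨r, p, s, d, q, hr, hd, h1, h2, h3, h4, h5, h6⟩ := H.polyD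
  have hr2 : 0 < r ^ 2 := by positivity
  have hr3 : r ^ 3 ≠ 0 := pow_ne_zero 3 hr
  have hc : ∀ {b c h i j}, ParamD b c h i j → c = -1 ∨ c = 0 := by
    unfold ParamD; tauto
  obtain rfl : c = c' := by
    rcases hc hP with rfl | rfl <;> rcases hc hP' with rfl | rfl <;> simp [hr, hd] at h1 ⊢
  have hsign := @eq_of_sign_eq_mul h h' (r ^ 2) hr2
  have hunit : r ^ 2 = 1 → r = 1 ∨ r = -1 := fun h => by simpa using h
  rcases hc hP with rfl | rfl
  · obtain ⟨rfl, rfl⟩ : b' = 0 ∧ i' = 0 := by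
      unfold ParamD at hP'; grind
    have hrpos : 0 < r := by
      have : 0 < r ^ 3 := by nlinarith [sq_pos_of_ne_zero hd]
      exact (Odd.pow_pos_iff (by decide)).mp this
    obtain rfl : s = 0 := by simpa [hd] using h2
    obtain rfl : p = 0 := by simpa [hr] using h3
    obtain rfl : q = 0 := by simpa [hd] using h5
    have h4' : h = r ^ 2 * h' := mul_left_cancel₀ hr (by linear_combination h4)
    have h6' : j = r ^ 3 * j' := by linear_combination h6
    have hsign' := @eq_of_sign_eq_mul j j' (r ^ 3) (by positivity)
    simp [ParamD] at hP hP'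
    grind
  · obtain rfl : b' = 0 := by simpa [hr] using h2.symm
    obtain rfl : i' = 0 := by simpa [hr] using h5.symm
    obtain rfl : p = 0 := by simpa [hr] using h3
    have h4' : h = r ^ 2 * h' := mul_left_cancel₀ hr (by linear_combination h4)
    have h6' : j = r ^ 3 * j' := by linear_combination h6
    have hJ := fun h => @eq_of_nonneg_of_sq_eq_one r j j' h
    simp [ParamD] at hP hP'
    grind

/-- The members of the Table all of whose equivalences come from affine maps. -/
def RigidForm (f : P2) : Prop :=
  (∃ a h i j, ParamA a h i j ∧ f = polyA a h i j) ∨ (∃ a h i j, ParamB a h i j ∧ f = polyB a h i j) ∨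
    (∃ a g i j, ParamC a g i j ∧ f = polyC a g i j) ∨
    ∃ c h j, ParamD 0 c h 0 j ∧ f = polyD 0 c h 0 j

lemma RigidForm.affRel {f g : P2} (hf : RigidForm f) (hg : g.totalDegree = 3)
    (h : AutEquiv f g) : AffRel f g := by
  rcases hf with ⟨a, h, i, j, hP, rfl⟩ | ⟨a, h, i, j, hP, rfl⟩ | ⟨a, h, i, j, hP, rfl⟩ |
    ⟨c, h, j, hP, rfl⟩
  · exact (polyA_affEquiv hg ‹_›).affRel
  · exact (polyB_affEquiv hg ‹_›).affRel
  · have ha : a = 1 ∨ a = 0 := by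
      unfold ParamC at hP; tauto
    rcases ha with rfl | rfl
    · exact (polyC_one_affEquiv hg ‹_›).affRel
    · exact (polyC_zero_affEquiv hg ‹_›).affRel
  · have hc : c = -1 ∨ c = 0 := by
      unfold ParamD at hP; tauto
    rcases hc with rfl | rfl
    · exact (weierstrass_affEquiv hg ‹_›).affRel
    · exact univariate_affRel hg ‹_›

lemma InTable.exists_param {p : P2} (H : InTable p) :
    (∃ a h i j, ParamA a h i j ∧ p = polyA a h i j) ∨
    (∃ a h i j, ParamB a h i j ∧ p = polyB a h i j) ∨
    (∃ a g i j, ParamC a g i j ∧ p = polyC a g i j) ∨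
    ∃ b c h i j, ParamD b c h i j ∧ p = polyD b c h i j := by
  rcases H with H | H | H | H
  · exact Or.inl H.exists_param
  · exact Or.inr (Or.inl H.exists_param)
  · exact Or.inr (Or.inr (Or.inl H.exists_param))
  · exact Or.inr (Or.inr (Or.inr H.exists_param))

lemma InTable.totalDegree {p : P2} (H : InTable p) : p.totalDegree = 3 := by
  rcases H.exists_param with ⟨_, _, _, _, -, rfl⟩ | ⟨_, _, _, _, -, rfl⟩ | ⟨_, _, _, _, -, rfl⟩ |
    ⟨_, _, _, _, _, -, rfl⟩
  · exact totalDegree_polyA ..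
  · exact totalDegree_polyB ..
  · exact totalDegree_polyC ..
  · exact totalDegree_polyD ..

lemma InTable.rigidForm_or {p : P2} (H : InTable p) :
    RigidForm p ∨ p = polyD 0 0 0 (-1) 0 ∨ p = polyD (-1) 0 0 0 1 ∨ p = polyD (-1) 0 0 0 0 := by
  rcases H.exists_param with h | h | h | ⟨b, c, h, i, j, hP, rfl⟩
  · exact Or.inl (Or.inl h)
  · exact Or.inl (Or.inr (Or.inl h))
  · exact Or.inl (Or.inr (Or.inr (Or.inl h)))
  · have hP' := hP
    rcases hP' with ⟨rfl, rfl, rfl, -⟩ | ⟨rfl, rfl, rfl, rfl, rfl⟩ | ⟨rfl, rfl, rfl, rfl, rfl | rfl⟩ |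
      ⟨rfl, rfl, rfl, -⟩
    · exact Or.inl (Or.inr (Or.inr (Or.inr ⟨_, _, _, hP, rfl⟩)))
    · exact Or.inr (Or.inl rfl)
    · exact Or.inr (Or.inr (Or.inl rfl))
    · exact Or.inr (Or.inr (Or.inr rfl))
    · exact Or.inl (Or.inr (Or.inr (Or.inr ⟨_, _, _, hP, rfl⟩)))

lemma RigidForm.eq_of_affRel {f g : P2} (hf : RigidForm f) (hg : InTable g) (H : AffRel f g) :
    f = g := by
  rcases hf with ⟨a, h, i, j, hP, rfl⟩ | ⟨a, h, i, j, hP, rfl⟩ | ⟨a, h, i, j, hP, rfl⟩ |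
    ⟨c, h, j, hP, rfl⟩ <;>
  rcases hg.exists_param with ⟨a', h', i', j', hP', rfl⟩ | ⟨a', h', i', j', hP', rfl⟩ |
    ⟨a', h', i', j', hP', rfl⟩ | ⟨b', c', h', i', j', hP', rfl⟩
  case inl.inl => exact hP.eq_of_affRel hP' H
  case inr.inl.inr.inl => exact hP.eq_of_affRel hP' H
  case inr.inr.inl.inr.inr.inl => exact hP.eq_of_affRel hP' H
  case inr.inr.inr.inr.inr.inr => exact hP.eq_of_affRel hP' H
  case inr.inr.inl.inr.inr.inr => exact absurd H not_affRel_polyC_polyD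
  case inr.inr.inr.inr.inr.inl => exact absurd H not_affRel_polyD_polyC
  all_goals
    simp only [polyA_eq_cubic, polyB_eq_cubic, polyC_eq_cubic, polyD_eq_cubic] at H
    obtain ⟨r, hr, h⟩ := H.disc
    norm_num [disc] at h <;> linarith

/-- Equivalences transport critical points and scale critical values. -/
lemma AutEquiv.exists_critical {f g : P2} (h : AutEquiv f g) {x y : ℝ}
    (h0 : ev (pderiv 0 g) x y = 0) (h1 : ev (pderiv 1 g) x y = 0) :
    ∃ u v c : ℝ, c ≠ 0 ∧ ev (pderiv 0 f) u v = 0 ∧ ev (pderiv 1 f) u v = 0 ∧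
      ev f u v = c * ev g x y := by
  obtain ⟨φ, c, hc, h⟩ := h
  obtain ⟨k, hk, hJ⟩ := exists_jac_eq_C φ
  have hev : ∀ (r : P2) (u v : ℝ), eval ![u, v] r = ev r u v := fun _ _ _ => rfl
  refine ⟨ev (φ (X 0)) x y, ev (φ (X 1)) x y, c, hc, ?_, ?_, ?_⟩
  all_goals
    have e0 := congrArg (fun r => ev (pderiv 0 r) x y) h
    have e1 := congrArg (fun r => ev (pderiv 1 r) x y) h
    have e := congrArg (fun r => ev r x y) h
    have eJ := congrArg (fun r => ev r x y) hJ
    rw [pderiv_ringEquiv φ, pderiv_C_mul] at e0 e1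
    simp only [ev, jac, map_add, map_sub, map_mul, eval_C] at e0 e1 e eJ h0 h1
    simp only [hev] at e0 e1 e eJ h0 h1
    rw [ev_ringEquiv φ (pderiv 0 f), ev_ringEquiv φ (pderiv 1 f)] at e0 e1
    rw [ev_ringEquiv φ f] at e
    rw [h0] at e0
    rw [h1] at e1
  · apply mul_left_cancel₀ hk
    rw [← eJ]
    linear_combination e0 * ev (pderiv 1 (φ (X 1))) x y - e1 * ev (pderiv 0 (φ (X 1))) x y
  · apply mul_left_cancel₀ hk
    rw [← eJ]
    linear_combination -e0 * ev (pderiv 1 (φ (X 0))) x y + e1 * ev (pderiv 0 (φ (X 0))) x y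
  · exact e

lemma ev_pderiv_zero_polyD (b c h i j x y : ℝ) :
    ev (pderiv 0 (polyD b c h i j)) x y = 3 * x ^ 2 + b * y + h := by
  simp [ev, polyD, Derivation.leibniz_pow]

lemma ev_pderiv_one_polyD (b c h i j x y : ℝ) :
    ev (pderiv 1 (polyD b c h i j)) x y = b * x + 2 * c * y + i := by
  simp [ev, polyD, Derivation.leibniz_pow]; ring

lemma not_autEquiv_graph (J : ℝ) : ¬ AutEquiv (polyD 0 0 0 (-1) 0) (polyD (-1) 0 0 0 J) := by
  intro h
  obtain ⟨u, v, c, -, -, h1, -⟩ := h.exists_critical (x := 0) (y := 0)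
    (by simp [ev_pderiv_zero_polyD]) (by simp [ev_pderiv_one_polyD])
  simp [ev_pderiv_one_polyD] at h1

lemma not_autEquiv_trident : ¬ AutEquiv (polyD (-1) 0 0 0 1) (polyD (-1) 0 0 0 0) := by
  intro h
  obtain ⟨u, v, c, -, h0, h1, h2⟩ := h.exists_critical (x := 0) (y := 0)
    (by simp [ev_pderiv_zero_polyD]) (by simp [ev_pderiv_one_polyD])
  simp only [ev_pderiv_zero_polyD, ev_pderiv_one_polyD] at h0 h1
  obtain rfl : u = 0 := by linarith
  simp [ev, polyD] at h2

theorem InTable.eq_of_autEquiv {f g : P2} (hf : InTable f) (hg : InTable g) (h : AutEquiv f g) :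
    f = g := by
  rcases hf.rigidForm_or with hr | hf'
  · exact hr.eq_of_affRel hg (hr.affRel hg.totalDegree h)
  rcases hg.rigidForm_or with hr | hg'
  · exact (hr.eq_of_affRel hf (hr.affRel hf.totalDegree h.symm)).symm
  rcases hf' with rfl | rfl | rfl <;> rcases hg' with rfl | rfl | rfl
  · rfl
  · exact absurd h (not_autEquiv_graph _)
  · exact absurd h (not_autEquiv_graph _)
  · exact absurd h.symm (not_autEquiv_graph _)
  · rfl
  · exact absurd h not_autEquiv_trident
  · exact absurd h.symm (not_autEquiv_graph _)
  · exact absurd h.symm not_autEquiv_trident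
  · rfl

/-- `f` is equivalent to a member of the Table. -/
def HasTableForm (f : P2) : Prop := ∃ g, InTable g ∧ AutEquiv f g

lemma AffRel.hasTableForm {f g : P2} (h : AffRel f g) (hg : HasTableForm g) : HasTableForm f := by
  obtain ⟨g', hg', h'⟩ := hg
  exact ⟨g', hg', h.autEquiv.trans h'⟩

lemma AffRel.refl (f : P2) : AffRel f f :=
  ⟨1, 0, 0, 0, 1, 0, 1, by norm_num, one_ne_zero, fun x y => by simp⟩

lemma AffRel.hasTableForm_of_inTable {f g : P2} (h : AffRel f g) (hg : InTable g) :
    HasTableForm f := ⟨g, hg, h.autEquiv⟩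

lemma exists_sign (r : ℝ) : ∃ e : ℝ, (e = 1 ∨ e = -1) ∧ 0 ≤ e * r := by
  rcases le_total 0 r with h | h
  · exact ⟨1, by simp, by simpa⟩
  · exact ⟨-1, by simp, by simpa⟩

lemma exists_pow_eq_abs {r : ℝ} (hr : r ≠ 0) {n : ℕ} (hn : n ≠ 0) :
    ∃ t : ℝ, 0 < t ∧ t ^ n = |r| :=
  ⟨|r| ^ (n : ℝ)⁻¹, Real.rpow_pos_of_pos (abs_pos.mpr hr) _,
    Real.rpow_inv_natCast_pow (abs_nonneg r) hn⟩

lemma exists_cube_eq {r : ℝ} (hr : r ≠ 0) : ∃ t : ℝ, t ≠ 0 ∧ t ^ 3 = r := by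
  obtain ⟨t, ht, h⟩ := exists_pow_eq_abs hr (n := 3) (by norm_num)
  rcases abs_choice r with h' | h' <;> rw [h'] at h
  · exact ⟨t, ht.ne', h⟩
  · exact ⟨-t, neg_ne_zero.mpr ht.ne', by linear_combination -h⟩

/-- A square root of `|r|` whose sign is adapted to `j`. -/
lemma exists_sq_eq_abs {r : ℝ} (hr : r ≠ 0) (j : ℝ) :
    ∃ t : ℝ, t ≠ 0 ∧ t ^ 2 = |r| ∧ 0 ≤ j / t := by
  obtain ⟨t, ht, h⟩ := exists_pow_eq_abs hr (n := 2) (by norm_num)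
  rcases le_total 0 j with hj | hj
  · exact ⟨t, ht.ne', h, by positivity⟩
  · exact ⟨-t, neg_ne_zero.mpr ht.ne', by linear_combination h,
      div_nonneg_of_nonpos hj (by linarith)⟩

lemma div_cube_nonneg {j t : ℝ} (h : 0 ≤ j / t) : 0 ≤ j / t ^ 3 := by
  have : j / t ^ 3 = j / t / t ^ 2 := by rw [div_div]; ring
  rw [this]; positivity

lemma div_abs_eq {r : ℝ} (hr : r ≠ 0) : r / |r| = 1 ∨ r / |r| = -1 := by
  rcases abs_choice r with h | h <;> rw [h]
  · exact Or.inl (div_self hr)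
  · exact Or.inr (by rw [div_neg, div_self hr])

lemma affRel_polyA_scale (a h i j : ℝ) {t e : ℝ} (ht : t ≠ 0) (he : e = 1 ∨ e = -1) :
    AffRel (polyA a h i j) (polyA (a / t) (h / t ^ 2) (e * i / t ^ 2) (j / t ^ 3)) := by
  refine ⟨t, 0, 0, 0, e * t, 0, t ^ 3, ?_, by positivity, fun x y => ?_⟩
  · rcases he with rfl | rfl <;> simp [ht]
  · rw [polyA_eq_cubic, polyA_eq_cubic, ev_cubic_poly, ev_cubic_poly]
    rcases he with rfl | rfl <;> field_simp <;> ring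

lemma affRel_polyB_scale (a h i j : ℝ) {t e : ℝ} (ht : t ≠ 0) (he : e = 1 ∨ e = -1) :
    AffRel (polyB a h i j) (polyB (a / t) (h / t ^ 2) (e * i / t ^ 2) (j / t ^ 3)) := by
  refine ⟨t, 0, 0, 0, e * t, 0, t ^ 3, ?_, by positivity, fun x y => ?_⟩
  · rcases he with rfl | rfl <;> simp [ht]
  · rw [polyB_eq_cubic, polyB_eq_cubic, ev_cubic_poly, ev_cubic_poly]
    rcases he with rfl | rfl <;> field_simp <;> ring

lemma affRel_polyC_scale (a g i j : ℝ) {s t : ℝ} (hs : s ≠ 0) (ht : t ≠ 0) :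
    AffRel (polyC a g i j)
      (polyC (a * t / s ^ 2) (g / (s * t)) (i / s ^ 2) (j / (s ^ 2 * t))) := by
  refine ⟨s, 0, 0, 0, t, 0, s ^ 2 * t, by simp [hs, ht], by positivity, fun x y => ?_⟩
  rw [polyC_eq_cubic, polyC_eq_cubic, ev_cubic_poly, ev_cubic_poly]
  field_simp
  ring

lemma affRel_polyD_scale (b c h i j : ℝ) {s t : ℝ} (hs : s ≠ 0) (ht : t ≠ 0) :
    AffRel (polyD b c h i j)
      (polyD (b * t / s ^ 2) (c * t ^ 2 / s ^ 3) (h / s ^ 2) (i * t / s ^ 3) (j / s ^ 3)) := by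
  refine ⟨s, 0, 0, 0, t, 0, s ^ 3, by simp [hs, ht], by positivity, fun x y => ?_⟩
  rw [polyD_eq_cubic, polyD_eq_cubic, ev_cubic_poly, ev_cubic_poly]
  field_simp
  ring

lemma ParamA.inTable {a h i j : ℝ} (H : ParamA a h i j) : InTable (polyA a h i j) := Or.inl H.famA

lemma ParamB.inTable {a h i j : ℝ} (H : ParamB a h i j) : InTable (polyB a h i j) :=
  Or.inr (Or.inl H.famB)

lemma ParamC.inTable {a g i j : ℝ} (H : ParamC a g i j) : InTable (polyC a g i j) :=
  Or.inr (Or.inr (Or.inl H.famC))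

lemma ParamD.inTable {b c h i j : ℝ} (H : ParamD b c h i j) : InTable (polyD b c h i j) :=
  Or.inr (Or.inr (Or.inr H.famD))

lemma hasTableForm_polyA (a h i j : ℝ) : HasTableForm (polyA a h i j) := by
  by_cases ha : a = 0
  · subst ha
    by_cases hi : i = 0
    · subst hi
      by_cases hh : h = 0
      · subst hh
        by_cases hj : j = 0
        · exact (affRel_polyA_scale 0 0 0 j one_ne_zero (Or.inl rfl)).hasTableForm_of_inTable
            (ParamA.inTable (by simp [ParamA, hj]))
        · obtain ⟨t, ht, h3⟩ := exists_cube_eq hj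
          exact (affRel_polyA_scale 0 0 0 j ht (Or.inl rfl)).hasTableForm_of_inTable
            (ParamA.inTable (by simp [ParamA, h3, hj]))
      · obtain ⟨t, ht, h2, h3⟩ := exists_sq_eq_abs hh j
        exact (affRel_polyA_scale 0 h 0 j ht (Or.inl rfl)).hasTableForm_of_inTable
          (ParamA.inTable (by simp [ParamA, div_cube_nonneg h3, h2, div_abs_eq hh]))
    · obtain ⟨t, ht, h2, h3⟩ := exists_sq_eq_abs hi j
      obtain ⟨e, he, hei⟩ := exists_sign i
      have hei' : e * i / t ^ 2 = 1 := by
        rw [h2, ← abs_of_nonneg hei, abs_mul]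
        rcases he with rfl | rfl <;> simp [hi]
      exact (affRel_polyA_scale 0 h i j ht he).hasTableForm_of_inTable
        (ParamA.inTable (by simp [ParamA, div_cube_nonneg h3, hei']))
  · obtain ⟨e, he, hei⟩ := exists_sign i
    exact (affRel_polyA_scale a h i j ha he).hasTableForm_of_inTable
      (ParamA.inTable (Or.inl ⟨div_self ha, by positivity⟩))

/-- The action on `polyB` of the rotation permuting the three linear factors of `x³ - xy²`. -/
lemma affRel_polyB_rotate (a h i j : ℝ) :
    ∃ j', AffRel (polyB a (h - 3 * a ^ 2 / 4) i j)
      (polyB a (-(h + 3 * i) / 2 - 3 * a ^ 2 / 4) ((h - i) / 2) j') := by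
  refine ⟨j + 3 * a * (h + i) / 4, -1 / 2, 1 / 2, 3 * a / 4, -3 / 2, -1 / 2, 3 * a / 4, 1, by norm_num,
    one_ne_zero, fun x y => ?_⟩
  rw [polyB_eq_cubic, polyB_eq_cubic, ev_cubic_poly, ev_cubic_poly]
  ring

/-- Every orbit of the symmetry group of `x³ - xy²` meets the chamber `0 ≤ i`, `h + i ≤ 0`. -/
lemma hasTableForm_polyB_of_chamber {a : ℝ}
    (H : ∀ h i j, 0 ≤ i → h + i ≤ 0 → HasTableForm (polyB a (h - 3 * a ^ 2 / 4) i j)) (h i j : ℝ) :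
    HasTableForm (polyB a (h - 3 * a ^ 2 / 4) i j) := by
  have H₁ : ∀ h i j, 0 ≤ i → i ≤ h → HasTableForm (polyB a (h - 3 * a ^ 2 / 4) i j) := by
    intro h i j h1 h2
    obtain ⟨j', hR⟩ := affRel_polyB_rotate a h i j
    exact hR.hasTableForm (H _ _ _ (by linarith) (by linarith))
  have H₂ : ∀ h i j, i ≤ h → h + i ≤ 0 → HasTableForm (polyB a (h - 3 * a ^ 2 / 4) i j) := by
    intro h i j h1 h2
    obtain ⟨j', hR⟩ := affRel_polyB_rotate a h i j
    exact hR.hasTableForm (H₁ _ _ _ (by linarith) (by linarith))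
  have H₃ : ∀ h i j, 0 ≤ i → HasTableForm (polyB a (h - 3 * a ^ 2 / 4) i j) := by
    intro h i j hi
    rcases le_total (h + i) 0 with h1 | h1
    · exact H _ _ _ hi h1
    rcases le_total i h with h2 | h2
    · exact H₁ _ _ _ hi h2
    · have hR := affRel_polyB_scale a (h - 3 * a ^ 2 / 4) i j one_ne_zero (Or.inr rfl)
      simp only [div_one, one_pow, neg_one_mul] at hR
      exact hR.hasTableForm (H₂ _ _ _ (by linarith) (by linarith))
  rcases le_total 0 i with hi | hi
  · exact H₃ _ _ _ hi
  · have hR := affRel_polyB_scale a (h - 3 * a ^ 2 / 4) i j one_ne_zero (Or.inr rfl)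
    simp only [div_one, one_pow, neg_one_mul] at hR
    exact hR.hasTableForm (H₃ _ _ _ (by linarith))

lemma hasTableForm_polyB_zero_of_le {h i j : ℝ} (h1 : i ≤ h) (h2 : h ≤ -i) :
    HasTableForm (polyB 0 h i j) := by
  by_cases hi : i = 0
  · subst hi
    obtain rfl : h = 0 := by linarith
    by_cases hj : j = 0
    · exact (affRel_polyB_scale 0 0 0 j one_ne_zero (Or.inl rfl)).hasTableForm_of_inTable
        (ParamB.inTable (by simp [ParamB, hj]))
    · obtain ⟨t, ht, h3⟩ := exists_cube_eq hj
      exact (affRel_polyB_scale 0 0 0 j ht (Or.inl rfl)).hasTableForm_of_inTable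
        (ParamB.inTable (by simp [ParamB, h3, hj]))
  · obtain ⟨t, ht, h2', h3⟩ := exists_sq_eq_abs hi j
    have hi' : 0 < -i := by
      have : i ≤ 0 := by linarith
      have := lt_of_le_of_ne this hi
      linarith
    rw [abs_of_nonpos (by linarith)] at h2'
    refine (affRel_polyB_scale 0 h i j ht (Or.inl rfl)).hasTableForm_of_inTable
      (ParamB.inTable (Or.inr (Or.inl ⟨by simp, ?_, div_cube_nonneg h3, ?_, ?_⟩))) <;> rw [h2']
    · field_simp
    · rw [le_div_iff₀ hi']; linarith
    · rw [div_le_iff₀ hi']; linarith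

lemma hasTableForm_polyB (a h i j : ℝ) : HasTableForm (polyB a h i j) := by
  by_cases ha : a = 0
  · subst ha
    have := hasTableForm_polyB_of_chamber (a := 0) (fun h i j h1 h2 => ?_) h i j
    · simpa using this
    · obtain ⟨j', hR⟩ := affRel_polyB_rotate 0 h i j
      refine hR.hasTableForm ?_
      simp only [ne_eq, OfNat.ofNat_ne_zero, not_false_eq_true, zero_pow, mul_zero, zero_div, sub_zero]
      exact hasTableForm_polyB_zero_of_le (by linarith) (by linarith)
  · have hR := affRel_polyB_scale a h i j (neg_ne_zero.mpr ha) (Or.inl rfl)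
    rw [div_neg, div_self ha] at hR
    refine hR.hasTableForm ?_
    have := hasTableForm_polyB_of_chamber (a := -1) (fun h i j h1 h2 => ?_)
      (h / (-a) ^ 2 + 3 / 4) (1 * i / (-a) ^ 2) (j / (-a) ^ 3)
    · norm_num at this ⊢
      exact this
    · exact ⟨_, ParamB.inTable (Or.inl ⟨rfl, h1, by linarith⟩), (AffRel.refl _).autEquiv⟩

lemma hasTableForm_polyC (a g i j : ℝ) : HasTableForm (polyC a g i j) := by
  by_cases ha : a = 0
  · subst ha
    by_cases hg : g = 0
    · subst hg
      by_cases hj : j = 0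
      · subst hj
        by_cases hi : i = 0
        · exact (affRel_polyC_scale 0 0 i 0 one_ne_zero one_ne_zero).hasTableForm_of_inTable
            (ParamC.inTable (by simp [ParamC, hi]))
        · obtain ⟨s, hs, h2⟩ := exists_pow_eq_abs hi two_ne_zero
          exact (affRel_polyC_scale 0 0 i 0 hs.ne' one_ne_zero).hasTableForm_of_inTable
            (ParamC.inTable (by simp [ParamC, h2, div_abs_eq hi]))
      · by_cases hi : i = 0
        · exact (affRel_polyC_scale 0 0 i j one_ne_zero (neg_ne_zero.mpr hj)).hasTableForm_of_inTable
            (ParamC.inTable (by simp [ParamC, hi, div_neg, hj]))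
        · obtain ⟨s, hs, h2⟩ := exists_pow_eq_abs hi two_ne_zero
          have e : j / (s ^ 2 * (j / s ^ 2)) = 1 := by field_simp
          exact (affRel_polyC_scale 0 0 i j hs.ne' (t := j / s ^ 2)
            (by positivity)).hasTableForm_of_inTable
            (ParamC.inTable (by rw [e, h2]; simp [ParamC, div_abs_eq hi]))
    · have key : ∀ s, s ≠ 0 → AffRel (polyC 0 g i j) (polyC 0 (-1) (i / s ^ 2) (-j / g / s)) := by
        intro s hs
        convert affRel_polyC_scale 0 g i j hs (t := -g / s) (by simp [hs, hg]) using 2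
        · simp
        · field_simp
        · field_simp
      by_cases hi : i = 0
      · by_cases hj : j = 0
        · exact (key 1 one_ne_zero).hasTableForm_of_inTable
            (ParamC.inTable (by simp [ParamC, hi, hj]))
        · have hjg : -j / g ≠ 0 := by simp [hj, hg]
          exact (key _ hjg).hasTableForm_of_inTable
            (ParamC.inTable (by rw [div_self hjg]; simp [ParamC, hi]))
      · obtain ⟨s, hs, h2, h3⟩ := exists_sq_eq_abs hi (-j / g)
        exact (key s hs).hasTableForm_of_inTable
            (ParamC.inTable (by rw [h2]; simp [ParamC, h3, div_abs_eq hi]))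
  · have key : ∀ s, s ≠ 0 →
        AffRel (polyC a g i j) (polyC 1 (g * a / s ^ 3) (i / s ^ 2) (j * a / s ^ 4)) := by
      intro s hs
      convert affRel_polyC_scale a g i j hs (t := s ^ 2 / a) (by positivity) using 2 <;> field_simp
    by_cases hg : g = 0
    · subst hg
      by_cases hi : i = 0
      · by_cases hj : j = 0
        · exact (key 1 one_ne_zero).hasTableForm_of_inTable
            (ParamC.inTable (by simp [ParamC, hi, hj]))
        · have hja : j * a ≠ 0 := mul_ne_zero hj ha
          obtain ⟨s, hs, h4⟩ := exists_pow_eq_abs hja four_ne_zero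
          refine (key s hs.ne').hasTableForm_of_inTable (ParamC.inTable ?_)
          rw [h4]
          rcases div_abs_eq hja with h | h <;> rw [h] <;> simp [ParamC, hi]
      · obtain ⟨s, hs, h2⟩ := exists_pow_eq_abs hi two_ne_zero
        exact (key s hs.ne').hasTableForm_of_inTable
          (ParamC.inTable (by rw [h2]; simp [ParamC, div_abs_eq hi]))
    · have hga : -(g * a) ≠ 0 := neg_ne_zero.mpr (mul_ne_zero hg ha)
      obtain ⟨s, hs, h3⟩ := exists_cube_eq hga
      exact (key s hs).hasTableForm_of_inTable
        (ParamC.inTable (Or.inl ⟨rfl, by rw [h3, div_neg, div_self (mul_ne_zero hg ha)]⟩))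

/-- The canonical forms `x³ + cy² + hx + j` with `c ≠ 0`. -/
lemma hasTableForm_polyD_of_square {c : ℝ} (hc : c ≠ 0) (h j : ℝ) :
    HasTableForm (polyD 0 c h 0 j) := by
  have key : ∀ m, 0 < m →
      AffRel (polyD 0 c h 0 j) (polyD 0 (-1) (h / c ^ 2 / m ^ 4) 0 (-j / c ^ 3 / m ^ 6)) := by
    intro m hm
    convert affRel_polyD_scale 0 c h 0 j (s := -(c * m ^ 2)) (t := c * m ^ 3)
      (neg_ne_zero.mpr (mul_ne_zero hc (by positivity))) (mul_ne_zero hc (by positivity)) using 2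
    · simp
    · field_simp
    · field_simp
    · simp
    · field_simp
  by_cases hh : h = 0
  · subst hh
    by_cases hj : j = 0
    · exact (key 1 one_pos).hasTableForm_of_inTable (ParamD.inTable (by simp [ParamD, hj]))
    · have hjc : -j / c ^ 3 ≠ 0 := by simp [hj, hc]
      obtain ⟨m, hm, h6⟩ := exists_pow_eq_abs hjc (n := 6) (by norm_num)
      refine (key m hm).hasTableForm_of_inTable (ParamD.inTable ?_)
      rw [h6]
      rcases div_abs_eq hjc with h | h <;> rw [h] <;> simp [ParamD]
  · have hhc : h / c ^ 2 ≠ 0 := by simp [hh, hc]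
    obtain ⟨m, hm, h4⟩ := exists_pow_eq_abs hhc four_ne_zero
    refine (key m hm).hasTableForm_of_inTable (ParamD.inTable ?_)
    rw [h4]
    rcases div_abs_eq hhc with h | h <;> rw [h] <;> simp [ParamD]

/-- The canonical forms `x³ + bxy + hx + iy + j` with `b ≠ 0`. -/
lemma hasTableForm_polyD_of_mixed {b : ℝ} (hb : b ≠ 0) (h i j : ℝ) :
    HasTableForm (polyD b 0 h i j) := by
  have key : ∃ j', AffRel (polyD b 0 h i j) (polyD (-1) 0 0 0 j') := by
    refine ⟨(-i / b) ^ 3 + h * (-i / b) + j, 1, 0, -i / b, 3 * i / b ^ 2, -1 / b,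
      -(3 * (-i / b) ^ 2 + h) / b, 1, ?_, one_ne_zero, fun x y => ?_⟩
    · simp [hb]
    · rw [polyD_eq_cubic, polyD_eq_cubic, ev_cubic_poly, ev_cubic_poly]
      field_simp
      ring
  obtain ⟨j', hj'⟩ := key
  refine hj'.hasTableForm ?_
  by_cases hj : j' = 0
  · exact ⟨_, ParamD.inTable (by simp [ParamD, hj]), (AffRel.refl _).autEquiv⟩
  · obtain ⟨s, hs, h3⟩ := exists_cube_eq hj
    exact (affRel_polyD_scale (-1) 0 0 0 j' hs (pow_ne_zero 2 hs)).hasTableForm_of_inTable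
      (ParamD.inTable (by simp [ParamD, h3, hj, hs]))

/-- The canonical forms `x³ + hx + iy + j`. -/
lemma hasTableForm_polyD_of_affine (h i j : ℝ) : HasTableForm (polyD 0 0 h i j) := by
  by_cases hi : i = 0
  · subst hi
    by_cases hh : h = 0
    · subst hh
      by_cases hj : j = 0
      · exact ⟨_, ParamD.inTable (by simp [ParamD, hj]), (AffRel.refl _).autEquiv⟩
      · obtain ⟨s, hs, h3⟩ := exists_cube_eq hj
        exact (affRel_polyD_scale 0 0 0 0 j hs one_ne_zero).hasTableForm_of_inTable
          (ParamD.inTable (by simp [ParamD, h3, hj]))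
    · obtain ⟨s, hs, h2, h3⟩ := exists_sq_eq_abs hh j
      exact (affRel_polyD_scale 0 0 h 0 j hs one_ne_zero).hasTableForm_of_inTable
        (ParamD.inTable (by simp [ParamD, div_cube_nonneg h3, h2, div_abs_eq hh]))
  · have key : AffRel (polyD 0 0 h i j) (polyD 0 0 0 (-1) 0) := by
      refine ⟨1, 0, 0, -h / i, -1 / i, -j / i, 1, by simp [hi], one_ne_zero, fun x y => ?_⟩
      rw [polyD_eq_cubic, polyD_eq_cubic, ev_cubic_poly, ev_cubic_poly]
      field_simp
      ring
    exact key.hasTableForm_of_inTable (ParamD.inTable (by simp [ParamD]))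

lemma hasTableForm_cubic_A (s t u v w z : ℝ) : HasTableForm (cubic 1 0 1 0 s t u v w z) := by
  have key : AffRel (cubic 1 0 1 0 s t u v w z) (polyA (s - 3 * u)
      (3 * u ^ 2 - t ^ 2 / 4 - 2 * s * u + v) (w - u * t)
      (ev (cubic 1 0 1 0 s t u v w z) (-u) (-t / 2))) := by
    refine ⟨1, 0, -u, 0, 1, -t / 2, 1, by norm_num, one_ne_zero, fun x y => ?_⟩
    simp only [polyA_eq_cubic, ev_cubic_poly]
    ring
  exact key.hasTableForm (hasTableForm_polyA ..)

lemma hasTableForm_cubic_B (s t u v w z : ℝ) : HasTableForm (cubic 1 0 (-1) 0 s t u v w z) := by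
  have key : AffRel (cubic 1 0 (-1) 0 s t u v w z) (polyB (u + s / 3)
      (t ^ 2 / 4 - s ^ 2 / 3 + v) (u * t + w)
      (ev (cubic 1 0 (-1) 0 s t u v w z) (-s / 3) (t / 2))) := by
    refine ⟨1, 0, -s / 3, 0, 1, t / 2, 1, by norm_num, one_ne_zero, fun x y => ?_⟩
    simp only [polyB_eq_cubic, ev_cubic_poly]
    ring
  exact key.hasTableForm (hasTableForm_polyB ..)

lemma hasTableForm_cubic_C (s t u v w z : ℝ) : HasTableForm (cubic 0 1 0 0 s t u v w z) := by
  have key : AffRel (cubic 0 1 0 0 s t u v w z) (polyC u (v - t * s)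
      (w - t ^ 2 / 4 - 2 * u * s) (ev (cubic 0 1 0 0 s t u v w z) (-t / 2) (-s))) := by
    refine ⟨1, 0, -t / 2, 0, 1, -s, 1, by norm_num, one_ne_zero, fun x y => ?_⟩
    simp only [polyC_eq_cubic, ev_cubic_poly]
    ring
  exact key.hasTableForm (hasTableForm_polyC ..)

lemma hasTableForm_cubic_D (s t u v w z : ℝ) : HasTableForm (cubic 1 0 0 0 s t u v w z) := by
  by_cases hu : u = 0
  · subst hu
    have key : AffRel (cubic 1 0 0 0 s t 0 v w z) (polyD t 0 (v - s ^ 2 / 3) (w - s * t / 3)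
        (ev (cubic 1 0 0 0 s t 0 v w z) (-s / 3) 0)) := by
      refine ⟨1, 0, -s / 3, 0, 1, 0, 1, by norm_num, one_ne_zero, fun x y => ?_⟩
      simp only [polyD_eq_cubic, ev_cubic_poly]
      ring
    refine key.hasTableForm ?_
    by_cases ht : t = 0
    · subst ht
      exact hasTableForm_polyD_of_affine ..
    · exact hasTableForm_polyD_of_mixed ht ..
  · have key : ∃ h j, AffRel (cubic 1 0 0 0 s t u v w z) (polyD 0 u h 0 j) := by
      set c := -t / (2 * u) with hc
      set p := -(s - t ^ 2 / (4 * u)) / 3 with hp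
      set q := -(t * p + w) / (2 * u) with hq
      have hc' : 2 * u * c + t = 0 := by rw [hc]; field_simp; ring
      have hp' : 3 * p + s + t * c + u * c ^ 2 = 0 := by rw [hp, hc]; field_simp; ring
      have hq' : 2 * u * q + t * p + w = 0 := by rw [hq]; field_simp; ring
      clear_value c p q
      refine ⟨3 * p ^ 2 + 2 * s * p + t * (q + c * p) + 2 * u * c * q + v + w * c,
        ev (cubic 1 0 0 0 s t u v w z) p q, 1, 0, p, c, 1, q, 1, by norm_num, one_ne_zero,
        fun x y => ?_⟩
      simp only [polyD_eq_cubic, ev_cubic_poly]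
      linear_combination x ^ 2 * hp' + x * y * hc' + y * hq'
    obtain ⟨h, j, key⟩ := key
    exact key.hasTableForm (hasTableForm_polyD_of_square hu ..)

/-- A linear substitution transforming the leading form of a cubic. -/
lemma exists_affRel_cubic {l₁ l₂ l₃ l₄ l₁' l₂' l₃' l₄' : ℝ} (a b c d k : ℝ)
    (hdet : a * d - b * c ≠ 0) (hk : k ≠ 0)
    (h₁ : l₁ * a ^ 3 + l₂ * a ^ 2 * c + l₃ * a * c ^ 2 + l₄ * c ^ 3 = k * l₁')
    (h₂ : 3 * l₁ * a ^ 2 * b + l₂ * (a ^ 2 * d + 2 * a * b * c) +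
      l₃ * (2 * a * c * d + b * c ^ 2) + 3 * l₄ * c ^ 2 * d = k * l₂')
    (h₃ : 3 * l₁ * a * b ^ 2 + l₂ * (2 * a * b * d + b ^ 2 * c) +
      l₃ * (a * d ^ 2 + 2 * b * c * d) + 3 * l₄ * c * d ^ 2 = k * l₃')
    (h₄ : l₁ * b ^ 3 + l₂ * b ^ 2 * d + l₃ * b * d ^ 2 + l₄ * d ^ 3 = k * l₄')
    (s t u v w z : ℝ) :
    ∃ s' t' u' v' w' z', AffRel (cubic l₁ l₂ l₃ l₄ s t u v w z)
      (cubic l₁' l₂' l₃' l₄' s' t' u' v' w' z') := by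
  refine ⟨(s * a ^ 2 + t * a * c + u * c ^ 2) / k,
    (2 * s * a * b + t * (a * d + b * c) + 2 * u * c * d) / k,
    (s * b ^ 2 + t * b * d + u * d ^ 2) / k, (v * a + w * c) / k, (v * b + w * d) / k, z / k,
    a, b, 0, c, d, 0, k, hdet, hk, fun x y => ?_⟩
  rw [ev_cubic_poly, ev_cubic_poly]
  field_simp
  linear_combination x ^ 3 * h₁ + x ^ 2 * y * h₂ + x * y ^ 2 * h₃ + y ^ 3 * h₄

lemma exists_root_monic_cubic (b c d : ℝ) : ∃ r, r ^ 3 + b * r ^ 2 + c * r + d = 0 := by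
  set M := 1 + |b| + |c| + |d| with hM
  have hM1 : 1 ≤ M := by
    linarith [abs_nonneg b, abs_nonneg c, abs_nonneg d]
  have bound : ∀ r, |r| = M → |b * r ^ 2 + c * r + d| ≤ M ^ 3 := fun r hr => calc
    |b * r ^ 2 + c * r + d| ≤ |b * r ^ 2| + |c * r| + |d| := abs_add_three ..
    _ = |b| * M ^ 2 + |c| * M + |d| * 1 := by rw [abs_mul, abs_mul, abs_pow, hr, mul_one]
    _ ≤ |b| * M ^ 2 + |c| * M ^ 2 + |d| * M ^ 2 := by
      gcongr
      · exact le_self_pow₀ hM1 two_ne_zero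
      · exact one_le_pow₀ hM1
    _ = (M - 1) * M ^ 2 := by rw [hM]; ring
    _ ≤ M ^ 3 := by nlinarith [sq_nonneg M]
  have hpos := abs_le.mp (bound M (abs_of_pos (by linarith)))
  have hneg := abs_le.mp (bound (-M) (by rw [abs_neg, abs_of_pos (by linarith)]))
  obtain ⟨r, -, hr⟩ := intermediate_value_Icc (a := -M) (b := M) (by linarith)
    (f := fun r => r ^ 3 + b * r ^ 2 + c * r + d) (by fun_prop)
    (show (0 : ℝ) ∈ _ from ⟨by linarith [hneg.2], by linarith [hpos.1]⟩)
  exact ⟨r, hr⟩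

lemma exists_root_cubic {a : ℝ} (ha : a ≠ 0) (b c d : ℝ) :
    ∃ r, a * r ^ 3 + b * r ^ 2 + c * r + d = 0 := by
  obtain ⟨r, hr⟩ := exists_root_monic_cubic (b / a) (c / a) (d / a)
  refine ⟨r, ?_⟩
  field_simp at hr
  linear_combination hr

lemma hasTableForm_of_dvd {l₁ l₂ l₃ : ℝ} (hl : ¬(l₁ = 0 ∧ l₂ = 0 ∧ l₃ = 0)) (s t u v w z : ℝ) :
    HasTableForm (cubic l₁ l₂ l₃ 0 s t u v w z) := by
  by_cases h₃ : l₃ = 0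
  · subst h₃
    by_cases h₂ : l₂ = 0
    · subst h₂
      have h₁ : l₁ ≠ 0 := by simpa using hl
      obtain ⟨s', t', u', v', w', z', h⟩ := exists_affRel_cubic (l₁ := l₁) (l₂ := 0) (l₃ := 0)
        (l₄ := 0) (l₁' := 1) (l₂' := 0) (l₃' := 0) (l₄' := 0) 1 0 0 1 l₁ (by norm_num) h₁
        (by ring) (by ring) (by ring) (by ring) s t u v w z
      exact h.hasTableForm (hasTableForm_cubic_D ..)
    · obtain ⟨s', t', u', v', w', z', h⟩ := exists_affRel_cubic (l₁ := l₁) (l₂ := l₂) (l₃ := 0)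
        (l₄ := 0) (l₁' := 0) (l₂' := 1) (l₃' := 0) (l₄' := 0) 1 0 (-l₁ / l₂) 1 l₂ (by norm_num) h₂
        (by field_simp; ring) (by ring) (by ring) (by ring) s t u v w z
      exact h.hasTableForm (hasTableForm_cubic_C ..)
  · by_cases hδ : l₁ - l₂ ^ 2 / (4 * l₃) = 0
    · obtain ⟨s', t', u', v', w', z', h⟩ := exists_affRel_cubic (l₁ := l₁) (l₂ := l₂) (l₃ := l₃)
        (l₄ := 0) (l₁' := 0) (l₂' := 1) (l₃' := 0) (l₄' := 0) 0 1 1 (-l₂ / (2 * l₃)) l₃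
        (by norm_num) h₃ (by ring) (by ring) (by field_simp; ring)
        (by rw [sub_eq_zero.mp hδ]; field_simp; ring) s t u v w z
      exact h.hasTableForm (hasTableForm_cubic_C ..)
    · obtain ⟨m, hm, h2⟩ := exists_pow_eq_abs (div_ne_zero hδ h₃) two_ne_zero
      have key : ∀ e, l₃ * m ^ 2 = (l₁ - l₂ ^ 2 / (4 * l₃)) * e → ∃ s' t' u' v' w' z',
          AffRel (cubic l₁ l₂ l₃ 0 s t u v w z) (cubic 1 0 e 0 s' t' u' v' w' z') := fun e he =>
        exists_affRel_cubic 1 0 (-l₂ / (2 * l₃)) m (l₁ - l₂ ^ 2 / (4 * l₃)) (by simp [hm.ne']) hδ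
          (by field_simp; ring) (by field_simp; ring) (by rw [← he]; ring) (by ring) ..
      rcases abs_choice ((l₁ - l₂ ^ 2 / (4 * l₃)) / l₃) with h | h <;> rw [h] at h2
      · obtain ⟨s', t', u', v', w', z', h⟩ := key 1 (by rw [h2]; field_simp)
        exact h.hasTableForm (hasTableForm_cubic_A ..)
      · obtain ⟨s', t', u', v', w', z', h⟩ := key (-1) (by rw [h2]; field_simp)
        exact h.hasTableForm (hasTableForm_cubic_B ..)

theorem hasTableForm {f : P2} (hf : f.totalDegree = 3) : HasTableForm f := by
  obtain ⟨l₁, l₂, l₃, l₄, s, t, u, v, w, z, rfl⟩ := exists_eq_cubic hf.le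
  by_cases h₄ : l₄ = 0
  · subst h₄
    refine hasTableForm_of_dvd (fun h => ?_) ..
    obtain ⟨rfl, rfl, rfl⟩ := h
    have := totalDegree_cubic_le_two s t u v w z
    omega
  · obtain ⟨r, hr⟩ := exists_root_cubic h₄ l₃ l₂ l₁
    obtain ⟨s', t', u', v', w', z', h⟩ := exists_affRel_cubic (l₁ := l₁) (l₂ := l₂) (l₃ := l₃)
      (l₄ := l₄) (l₁' := l₄) (l₂' := l₃ + 3 * l₄ * r) (l₃' := l₂ + 2 * l₃ * r + 3 * l₄ * r ^ 2)
      (l₄' := 0) 0 1 1 r 1 (by norm_num) one_ne_zero (by ring) (by ring) (by ring)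
      (by linear_combination hr) s t u v w z
    exact h.hasTableForm (hasTableForm_of_dvd (by simp [h₄]) ..)

theorem stmt17 :
    (∀ f : P2, f.totalDegree = 3 → ∃ g : P2, InTable g ∧ AutEquiv f g) ∧
    (∀ g₁ g₂ : P2, InTable g₁ → InTable g₂ → g₁ ≠ g₂ → ¬ AutEquiv g₁ g₂) :=
  ⟨fun _ hf => hasTableForm hf, fun _ _ h₁ h₂ hne h => hne (h₁.eq_of_autEquiv h₂ h)⟩
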